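/- arXiv:1705.05775 — 3 statements merged into one kernel-verified Lean document; each statement's English description precedes it below -/
import Mathlib

section
/- (Nonlocal Brezis–Lieb lemma.) Let α ∈ (0,N) and p ∈ [1, 2N/(N+α)). If (u_n) is a sequence bounded in L^{2Np/(N+α)}(ℝ^N) that converges almost everywhere to a function u : ℝ^N → ℝ, then lim_{n→∞} ∫_{ℝ^N} | (I_α*|u_n|^p)(x) |u_n(x)|^p − (I_α*|u_n−u|^p)(x) |u_n(x)−u(x)|^p − (I_α*|u|^p)(x) |u(x)|^p | dx = 0. -/
open MeasureTheory Real Filter Topology ENNReal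

noncomputable section

abbrev Sp (N : ℕ) := EuclideanSpace ℝ (Fin N)

/-- The Riesz potential `(I_γ * f)(x) = ∫ f(y) |x-y|^{γ-N} dy`. -/
noncomputable def riesz (N : ℕ) (γ : ℝ) (f : Sp N → ℝ) (x : Sp N) : ℝ :=
  ∫ y, f y * ‖x - y‖ ^ (γ - (N : ℝ))

/-- Polar coordinates for radial lower Lebesgue integrals. -/
lemma lint_radial (N : ℕ) (hN : 3 ≤ N) (f : ℝ → ℝ) (hf : ∀ y, 0 ≤ f y)
    (hi : IntegrableOn (fun y : ℝ => y ^ (N - 1) * f y) (Set.Ioi 0)) :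
    ∫⁻ x : Sp N, ENNReal.ofReal (f ‖x‖) =
      ENNReal.ofReal (N * (volume : Measure (Sp N)).real (Metric.ball 0 1) *
        ∫ y in Set.Ioi (0 : ℝ), y ^ (N - 1) * f y) := by
  have : Nonempty (Fin N) := ⟨⟨0, by omega⟩⟩
  have hd : Module.finrank ℝ (Sp N) = N := by simp
  have h1 : Integrable (fun x : Sp N => f ‖x‖) volume := by
    rw [integrable_fun_norm_addHaar (volume : Measure (Sp N)), hd]
    simpa using hi
  rw [← ofReal_integral_eq_lintegral_ofReal h1 (Eventually.of_forall fun x => hf _)]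
  rw [integral_fun_norm_addHaar (volume : Measure (Sp N)), hd]
  simp [mul_assoc]

lemma near_int (N : ℕ) (hN : 3 ≤ N) (α : ℝ) (hα : 0 < α) (R : ℝ) (hR : 0 < R) :
    ∫⁻ x : Sp N, ENNReal.ofReal ((Set.Iic R).indicator (fun y => |y| ^ (α - N)) ‖x‖) =
      ENNReal.ofReal (N * (volume : Measure (Sp N)).real (Metric.ball 0 1) / α) *
        ENNReal.ofReal (R ^ α) := by
  have e : ∀ y ∈ Set.Ioi (0 : ℝ), (Set.Ioc 0 R).indicator (fun y => y ^ (α - 1)) y =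
      y ^ (N - 1) * (Set.Iic R).indicator (fun y => |y| ^ (α - N)) y := by
    intro y hy
    have hy' : (0 : ℝ) < y := hy
    by_cases h : y ≤ R
    · simp only [Set.indicator, Set.mem_Ioc, Set.mem_Iic, h, hy', and_self, if_true]
      rw [abs_of_pos hy', ← Real.rpow_natCast, ← Real.rpow_add hy']
      congr 1
      rw [Nat.cast_sub (by omega)]; push_cast; ring
    · simp [Set.indicator, h]
  have hI : IntegrableOn ((Set.Ioc 0 R).indicator (fun y : ℝ => y ^ (α - 1))) (Set.Ioi 0) := by
    have : IntegrableOn (fun y : ℝ => y ^ (α - 1)) (Set.Ioc 0 R) := by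
      rw [← intervalIntegrable_iff_integrableOn_Ioc_of_le hR.le]
      exact intervalIntegral.intervalIntegrable_rpow' (by linarith)
    exact ((integrable_indicator_iff measurableSet_Ioc).2 this).integrableOn
  have hv : ∫ y in Set.Ioi (0 : ℝ), (Set.Ioc 0 R).indicator (fun y : ℝ => y ^ (α - 1)) y
      = R ^ α / α := by
    rw [setIntegral_indicator measurableSet_Ioc]
    rw [show Set.Ioi (0:ℝ) ∩ Set.Ioc 0 R = Set.Ioc 0 R by ext; simp]
    rw [← intervalIntegral.integral_of_le hR.le,
      integral_rpow (Or.inl (by linarith))]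
    simp [Real.zero_rpow hα.ne']
  rw [lint_radial N hN ((Set.Iic R).indicator (fun y => |y| ^ (α - N))) (fun y => Set.indicator_nonneg (fun _ _ => by positivity) _)]
  · rw [← setIntegral_congr_fun measurableSet_Ioi e, hv,
      ← ENNReal.ofReal_mul (by positivity)]
    congr 1; ring
  · exact hI.congr_fun e measurableSet_Ioi

lemma far_int (N : ℕ) (hN : 3 ≤ N) (R : ℝ) (hR : 0 < R) :
    ∫⁻ x : Sp N, ENNReal.ofReal ((Set.Ioi R).indicator (fun y => |y| ^ (-2 * N : ℝ)) ‖x‖) =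
      ENNReal.ofReal ((volume : Measure (Sp N)).real (Metric.ball 0 1)) *
        ENNReal.ofReal (R ^ (-N : ℝ)) := by
  have hN0 : (0:ℝ) < N := by positivity
  have hN3 : (3:ℝ) ≤ N := by exact_mod_cast hN
  have e : ∀ y ∈ Set.Ioi (0 : ℝ), (Set.Ioi R).indicator (fun y => y ^ (-N - 1 : ℝ)) y =
      y ^ (N - 1) * (Set.Ioi R).indicator (fun y => |y| ^ (-2 * N : ℝ)) y := by
    intro y hy
    have hy' : (0 : ℝ) < y := hy
    by_cases h : R < y
    · simp only [Set.indicator, Set.mem_Ioi, h, if_true]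
      rw [abs_of_pos hy', ← Real.rpow_natCast, ← Real.rpow_add hy']
      congr 1
      rw [Nat.cast_sub (by omega)]; push_cast; ring
    · simp [Set.indicator, h]
  have hI : IntegrableOn ((Set.Ioi R).indicator (fun y : ℝ => y ^ (-N - 1 : ℝ))) (Set.Ioi 0) := by
    have : IntegrableOn (fun y : ℝ => y ^ (-N - 1 : ℝ)) (Set.Ioi R) :=
      integrableOn_Ioi_rpow_of_lt (by linarith) hR
    exact ((integrable_indicator_iff measurableSet_Ioi).2 this).integrableOn
  have hv : ∫ y in Set.Ioi (0 : ℝ), (Set.Ioi R).indicator (fun y : ℝ => y ^ (-N - 1 : ℝ)) y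
      = R ^ (-N : ℝ) / N := by
    rw [setIntegral_indicator measurableSet_Ioi]
    rw [show Set.Ioi (0:ℝ) ∩ Set.Ioi R = Set.Ioi R by
      ext x; simp only [Set.mem_inter_iff, Set.mem_Ioi]; constructor
      · tauto
      · intro h; exact ⟨hR.trans h, h⟩]
    rw [integral_Ioi_rpow_of_lt (by linarith) hR]
    simp [neg_div_neg_eq]
  rw [lint_radial N hN ((Set.Ioi R).indicator (fun y => |y| ^ (-2 * N : ℝ))) (fun y => Set.indicator_nonneg (fun _ _ => by positivity) _)]
  · rw [← setIntegral_congr_fun measurableSet_Ioi e, hv,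
      ← ENNReal.ofReal_mul (by positivity)]
    congr 1; field_simp
  · exact hI.congr_fun e measurableSet_Ioi

/-- The Riesz kernel with values in `[0,∞]`. -/
def KK (N : ℕ) (α : ℝ) (z : Sp N) : ℝ≥0∞ := ENNReal.ofReal (‖z‖ ^ (α - (N : ℝ)))

/-- The Riesz potential with values in `[0,∞]`. -/
def TT (N : ℕ) (α : ℝ) (f : Sp N → ℝ≥0∞) (x : Sp N) : ℝ≥0∞ := ∫⁻ y, f y * KK N α (x - y)

lemma KK_meas (N : ℕ) (α : ℝ) : Measurable (KK N α) := by
  unfold KK; fun_prop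

lemma KK_sub_comm (N : ℕ) (α : ℝ) (x y : Sp N) : KK N α (x - y) = KK N α (y - x) := by
  unfold KK; rw [norm_sub_rev]

lemma hold_conj (N : ℕ) (hN : 3 ≤ N) (α : ℝ) (hα : α ∈ Set.Ioo (0 : ℝ) (N : ℝ)) :
    (2 * N / ((N : ℝ) + α)).HolderConjugate (2 * N / ((N : ℝ) - α)) := by
  obtain ⟨h0, h1⟩ := hα
  have hN3 : (3:ℝ) ≤ N := by exact_mod_cast hN
  have h2 : (0:ℝ) < N - α := by linarith
  rw [Real.holderConjugate_iff]
  constructor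
  · rw [lt_div_iff₀ (by linarith)]; linarith
  · field_simp; ring

/-- Key estimate: the potential of the part of `g` below level `c`. -/
lemma inner_est (N : ℕ) (hN : 3 ≤ N) (α : ℝ) (hα : α ∈ Set.Ioo (0 : ℝ) (N : ℝ)) :
    ∃ C : ℝ≥0∞, C ≠ ⊤ ∧ C ≠ 0 ∧ ∀ g : Sp N → ℝ≥0∞, Measurable g →
      ∫⁻ y, g y ^ (2 * N / ((N : ℝ) + α)) ≤ 1 → ∀ (c : ℝ), 0 < c → ∀ x,
      ∫⁻ y, {y | g y ≤ ENNReal.ofReal c}.indicator g y * KK N α (x - y) ≤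
        C * ENNReal.ofReal (c ^ (2 * N / ((N : ℝ) + α) - 1)) := by
  have hconj := hold_conj N hN α hα
  obtain ⟨h0, h1⟩ := hα
  have hN3 : (3:ℝ) ≤ N := by exact_mod_cast hN
  have h2 : (0:ℝ) < N - α := by linarith
  have h3 : (0:ℝ) < N + α := by linarith
  set s : ℝ := 2 * N / ((N : ℝ) + α) with hs
  set q : ℝ := 2 * N / ((N : ℝ) - α) with hq
  set v := (volume : Measure (Sp N)).real (Metric.ball 0 1) with hv
  have hqpos : 0 < q := by positivity
  refine ⟨ENNReal.ofReal (N * v / α) + ENNReal.ofReal v ^ (1 / q) + 1, ?_, by simp, ?_⟩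
  · simp only [ne_eq, ENNReal.add_eq_top, not_or, ENNReal.ofReal_ne_top, not_false_iff, true_and,
      ENNReal.one_ne_top, and_true]
    exact ENNReal.rpow_ne_top_of_nonneg (by positivity) ENNReal.ofReal_ne_top
  intro g hg hg1 c hc x
  set R : ℝ := c ^ (-2 / ((N : ℝ) + α)) with hRdef
  have hR : 0 < R := by positivity
  let φ : ℝ → ℝ := (Set.Iic R).indicator (fun y => |y| ^ (α - N))
  let ψ : ℝ → ℝ := (Set.Ioi R).indicator (fun y => |y| ^ (α - N))
  have hφm : Measurable φ := Measurable.indicator (by fun_prop) measurableSet_Iic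
  have hψm : Measurable ψ := Measurable.indicator (by fun_prop) measurableSet_Ioi
  have hφψ : ∀ z : Sp N, KK N α z = ENNReal.ofReal (φ ‖z‖) + ENNReal.ofReal (ψ ‖z‖) := by
    intro z
    by_cases hz : ‖z‖ ≤ R
    · simp [KK, φ, ψ, hz, not_lt.2 hz]
    · simp [KK, φ, ψ, hz, not_le.1 hz]
  have hpt : ∀ y, {y | g y ≤ ENNReal.ofReal c}.indicator g y * KK N α (x - y) ≤
      ENNReal.ofReal c * ENNReal.ofReal (φ ‖x - y‖) + g y * ENNReal.ofReal (ψ ‖x - y‖) := by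
    intro y
    rw [hφψ, mul_add]
    gcongr
    · by_cases h : g y ≤ ENNReal.ofReal c
      · simp [Set.indicator, h]
      · simp [Set.indicator, h]
    · exact Set.indicator_le_self _ _ _
  have hnear : ∫⁻ y, ENNReal.ofReal (φ ‖x - y‖) =
      ENNReal.ofReal (N * v / α) * ENNReal.ofReal (R ^ α) := by
    rw [lintegral_sub_left_eq_self (fun z => ENNReal.ofReal (φ ‖z‖)) x]
    exact near_int N hN α h0 R hR
  have hfar : ∫⁻ y, ENNReal.ofReal (ψ ‖x - y‖) ^ q =
      ENNReal.ofReal v * ENNReal.ofReal (R ^ (-N : ℝ)) := by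
    rw [lintegral_sub_left_eq_self (fun z => ENNReal.ofReal (ψ ‖z‖) ^ q) x]
    rw [← far_int N hN R hR]
    congr 1
    ext z
    by_cases hz : R < ‖z‖
    · simp only [ψ, Set.indicator, Set.mem_Ioi, hz, if_true]
      rw [ENNReal.ofReal_rpow_of_nonneg (by positivity) hqpos.le, ← Real.rpow_mul (by positivity)]
      congr 2
      rw [hq]; field_simp; ring
    · simp [ψ, Set.indicator, hz, hqpos]
  have hH : ∫⁻ y, g y * ENNReal.ofReal (ψ ‖x - y‖) ≤
      (ENNReal.ofReal v * ENNReal.ofReal (R ^ (-N : ℝ))) ^ (1 / q) := by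
    have := ENNReal.lintegral_mul_le_Lp_mul_Lq volume hconj hg.aemeasurable
      (g := fun y => ENNReal.ofReal (ψ ‖x - y‖)) (by fun_prop)
    refine this.trans ?_
    rw [hfar]
    calc _ ≤ (1:ℝ≥0∞) * (ENNReal.ofReal v * ENNReal.ofReal (R ^ (-N : ℝ))) ^ (1 / q) := by
          gcongr
          exact (ENNReal.rpow_le_rpow hg1 (by positivity)).trans (by simp)
      _ = _ := one_mul _
  have e1 : c * R ^ α = c ^ (s - 1) := by
    rw [hRdef, ← Real.rpow_mul hc.le]
    nth_rewrite 1 [← Real.rpow_one c]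
    rw [← Real.rpow_add hc]
    congr 1
    rw [hs]; field_simp; ring
  have e2 : (R ^ (-N : ℝ)) ^ (1 / q) = c ^ (s - 1) := by
    rw [hRdef, ← Real.rpow_mul hc.le, ← Real.rpow_mul hc.le]
    congr 1
    rw [hs, hq]; field_simp; ring
  calc _ ≤ ∫⁻ y, (ENNReal.ofReal c * ENNReal.ofReal (φ ‖x - y‖) +
          g y * ENNReal.ofReal (ψ ‖x - y‖)) := lintegral_mono hpt
    _ = ENNReal.ofReal c * (∫⁻ y, ENNReal.ofReal (φ ‖x - y‖)) +
          ∫⁻ y, g y * ENNReal.ofReal (ψ ‖x - y‖) := by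
        rw [lintegral_add_left (by fun_prop), lintegral_const_mul _ (by fun_prop)]
    _ ≤ ENNReal.ofReal c * (ENNReal.ofReal (N * v / α) * ENNReal.ofReal (R ^ α)) +
          (ENNReal.ofReal v * ENNReal.ofReal (R ^ (-N : ℝ))) ^ (1 / q) := by
        rw [hnear]; gcongr
    _ = ENNReal.ofReal (N * v / α) * ENNReal.ofReal (c ^ (s - 1)) +
          ENNReal.ofReal v ^ (1 / q) * ENNReal.ofReal (c ^ (s - 1)) := by
        congr 1
        · rw [← e1, ENNReal.ofReal_mul hc.le]; ring
        · rw [ENNReal.mul_rpow_of_nonneg _ _ (by positivity), ← e2,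
            ENNReal.ofReal_rpow_of_nonneg (x := R ^ (-N : ℝ)) (by positivity) (by positivity)]
    _ ≤ _ := by
        rw [← add_mul]
        exact mul_le_mul_left le_self_add _
lemma rpow_self_mul {s : ℝ} (hs : 1 ≤ s) (c : ℝ≥0∞) : c * c ^ (s - 1) = c ^ s := by
  nth_rewrite 1 [← ENNReal.rpow_one c]
  rw [← ENNReal.rpow_add_of_nonneg _ _ zero_le_one (by linarith)]
  congr 1; ring

lemma inner_est' (N : ℕ) (hN : 3 ≤ N) (α : ℝ) (hα : α ∈ Set.Ioo (0 : ℝ) (N : ℝ)) :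
    ∃ C : ℝ≥0∞, C ≠ ⊤ ∧ C ≠ 0 ∧ ∀ g : Sp N → ℝ≥0∞, Measurable g →
      ∫⁻ y, g y ^ (2 * N / ((N : ℝ) + α)) ≤ 1 → ∀ (c : ℝ≥0∞), ∀ x,
      ∫⁻ y, {y | g y ≤ c}.indicator g y * KK N α (x - y) ≤
        C * c ^ (2 * N / ((N : ℝ) + α) - 1) := by
  have hs1 := (hold_conj N hN α hα).lt
  obtain ⟨C, hC, hC0, H⟩ := inner_est N hN α hα
  refine ⟨C, hC, hC0, fun g hg hg1 c x => ?_⟩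
  rcases eq_or_ne c ⊤ with rfl | hct
  · rw [ENNReal.top_rpow_of_pos (by linarith), ENNReal.mul_top hC0]; exact le_top
  rcases eq_or_ne c 0 with rfl | hc0
  · have : ∀ y, {y | g y ≤ 0}.indicator g y * KK N α (x - y) = 0 := by
      intro y
      by_cases h : g y = 0 <;> simp [Set.indicator, h]
    simp only [this, lintegral_zero]; exact zero_le
  · have := H g hg hg1 c.toReal (ENNReal.toReal_pos hc0 hct) x
    rw [← ENNReal.ofReal_rpow_of_nonneg (by positivity) (by linarith)] at this
    rwa [ENNReal.ofReal_toReal hct] at this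

lemma TT_meas (N : ℕ) (α : ℝ) {f : Sp N → ℝ≥0∞} (hf : Measurable f) : Measurable (TT N α f) := by
  have := KK_meas N α
  unfold TT
  exact Measurable.lintegral_prod_right' (f := fun z : Sp N × Sp N => f z.2 * KK N α (z.1 - z.2))
    (by fun_prop)

lemma hls_unit (N : ℕ) (hN : 3 ≤ N) (α : ℝ) (hα : α ∈ Set.Ioo (0 : ℝ) (N : ℝ)) :
    ∃ C : ℝ≥0∞, C ≠ ⊤ ∧ C ≠ 0 ∧ ∀ f g : Sp N → ℝ≥0∞, Measurable f → Measurable g →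
      ∫⁻ y, f y ^ (2 * N / ((N : ℝ) + α)) ≤ 1 → ∫⁻ y, g y ^ (2 * N / ((N : ℝ) + α)) ≤ 1 →
      ∫⁻ x, f x * TT N α g x ≤ C := by
  have hs1 := (hold_conj N hN α hα).lt
  have hK := KK_meas N α
  obtain ⟨C, hC, hC0, H⟩ := inner_est' N hN α hα
  set s : ℝ := 2 * N / ((N : ℝ) + α) with hs
  refine ⟨C + C, by simp [hC], by simp [hC0], fun f g hf hg hf1 hg1 => ?_⟩
  have key : ∀ f g : Sp N → ℝ≥0∞, Measurable f → Measurable g →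
      ∫⁻ y, f y ^ s ≤ 1 → ∫⁻ y, g y ^ s ≤ 1 →
      ∫⁻ x, ∫⁻ y, f x * ({y | g y ≤ f x}.indicator g y * KK N α (x - y)) ≤ C := by
    intro f g hf hg hf1 hg1
    calc _ ≤ ∫⁻ x, C * f x ^ s := by
          apply lintegral_mono
          intro x
          dsimp only
          have hm : Measurable fun y => {y | g y ≤ f x}.indicator g y * KK N α (x - y) :=
            (hg.indicator (measurableSet_le hg measurable_const)).mul (by fun_prop)
          rw [lintegral_const_mul _ hm, ← rpow_self_mul hs1.le, mul_left_comm]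
          gcongr
          exact H g hg hg1 (f x) x
      _ ≤ C := by
          rw [lintegral_const_mul _ (by fun_prop)]
          calc _ ≤ C * 1 := by gcongr
            _ = C := mul_one _
  have m1 : Measurable (fun z : Sp N × Sp N =>
      f z.1 * ({y | g y ≤ f z.1}.indicator g z.2 * KK N α (z.1 - z.2))) := by
    refine (hf.comp measurable_fst).mul (Measurable.mul ?_ (by fun_prop))
    exact Measurable.ite (measurableSet_le (hg.comp measurable_snd) (hf.comp measurable_fst))
      (hg.comp measurable_snd) measurable_const
  have m2 : Measurable (fun z : Sp N × Sp N =>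
      g z.2 * ({x | f x ≤ g z.2}.indicator f z.1 * KK N α (z.2 - z.1))) := by
    refine (hg.comp measurable_snd).mul (Measurable.mul ?_ (by fun_prop))
    exact Measurable.ite (measurableSet_le (hf.comp measurable_fst) (hg.comp measurable_snd))
      (hf.comp measurable_fst) measurable_const
  calc ∫⁻ x, f x * TT N α g x = ∫⁻ x, ∫⁻ y, f x * (g y * KK N α (x - y)) := by
        congr 1; ext x
        rw [lintegral_const_mul _ (by fun_prop)]; rfl
    _ ≤ ∫⁻ x, ∫⁻ y, (f x * ({y | g y ≤ f x}.indicator g y * KK N α (x - y)) +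
          g y * ({x | f x ≤ g y}.indicator f x * KK N α (y - x))) := by
        apply lintegral_mono; intro x; apply lintegral_mono; intro y
        dsimp only
        rcases le_total (g y) (f x) with h | h
        · refine le_trans ?_ le_self_add
          simp [Set.indicator, h]
        · refine le_trans ?_ le_add_self
          simp only [Set.indicator, Set.mem_ofPred_eq, h, if_true]
          rw [KK_sub_comm, mul_left_comm]
    _ = (∫⁻ x, ∫⁻ y, f x * ({y | g y ≤ f x}.indicator g y * KK N α (x - y))) +
          ∫⁻ x, ∫⁻ y, g y * ({x | f x ≤ g y}.indicator f x * KK N α (y - x)) := by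
        rw [← lintegral_add_left m1.lintegral_prod_right']
        congr 1; ext x
        exact lintegral_add_left (m1.comp measurable_prodMk_left) _
    _ ≤ C + C := by
        gcongr
        · exact key f g hf hg hf1 hg1
        · rw [lintegral_lintegral_swap m2.aemeasurable]
          exact key g f hg hf hg1 hf1

/-- Hardy–Littlewood–Sobolev inequality, diagonal case. -/
lemma hls (N : ℕ) (hN : 3 ≤ N) (α : ℝ) (hα : α ∈ Set.Ioo (0 : ℝ) (N : ℝ)) :
    ∃ C : ℝ≥0∞, C ≠ ⊤ ∧ ∀ f g : Sp N → ℝ≥0∞, Measurable f → Measurable g →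
      ∫⁻ x, f x * TT N α g x ≤ C * ((∫⁻ y, f y ^ (2 * N / ((N : ℝ) + α))) ^
        (1 / (2 * N / ((N : ℝ) + α))) * (∫⁻ y, g y ^ (2 * N / ((N : ℝ) + α))) ^
        (1 / (2 * N / ((N : ℝ) + α)))) := by
  have hs1 := (hold_conj N hN α hα).lt
  have hK := KK_meas N α
  obtain ⟨C, hC, hC0, H⟩ := hls_unit N hN α hα
  set s : ℝ := 2 * N / ((N : ℝ) + α) with hs
  have hs0 : 0 < s := by linarith
  refine ⟨C, hC, fun f g hf hg => ?_⟩
  set a := (∫⁻ y, f y ^ s) ^ (1 / s) with ha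
  set b := (∫⁻ y, g y ^ s) ^ (1 / s) with hb
  have has : a ^ s = ∫⁻ y, f y ^ s := by
    rw [ha, ← ENNReal.rpow_mul, one_div_mul_cancel hs0.ne', ENNReal.rpow_one]
  have hbs : b ^ s = ∫⁻ y, g y ^ s := by
    rw [hb, ← ENNReal.rpow_mul, one_div_mul_cancel hs0.ne', ENNReal.rpow_one]
  rcases eq_or_ne a 0 with ha0 | ha0
  · rw [ha0, ENNReal.zero_rpow_of_pos hs0] at has
    have := ENNReal.ae_eq_zero_of_lintegral_rpow_eq_zero hs0.le hf.aemeasurable has.symm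
    have h0 : ∫⁻ x, f x * TT N α g x = 0 := by
      rw [lintegral_congr_ae (g := fun _ => 0)]; · simp
      filter_upwards [this] with x hx; simp [hx]
    rw [h0]; exact zero_le
  rcases eq_or_ne b 0 with hb0 | hb0
  · rw [hb0, ENNReal.zero_rpow_of_pos hs0] at hbs
    have := ENNReal.ae_eq_zero_of_lintegral_rpow_eq_zero hs0.le hg.aemeasurable hbs.symm
    have h0 : ∀ x, TT N α g x = 0 := by
      intro x
      unfold TT
      rw [lintegral_congr_ae (g := fun _ => 0)]; · simp
      filter_upwards [this] with x hx; simp [hx]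
    simp [h0]
  rcases eq_or_ne a ⊤ with hat | hat
  · rw [hat, ENNReal.top_mul hb0, ENNReal.mul_top hC0]; exact le_top
  rcases eq_or_ne b ⊤ with hbt | hbt
  · rw [hbt, ENNReal.mul_top ha0, ENNReal.mul_top hC0]; exact le_top
  have scale : ∀ (a : ℝ≥0∞) (f : Sp N → ℝ≥0∞), Measurable f → a ≠ 0 → a ≠ ⊤ →
      a ^ s = ∫⁻ y, f y ^ s → ∫⁻ y, (a⁻¹ * f y) ^ s ≤ 1 := by
    intro a f hf h0 ht h
    simp_rw [ENNReal.mul_rpow_of_nonneg _ _ hs0.le]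
    rw [lintegral_const_mul _ (by fun_prop), ← h, ENNReal.inv_rpow]
    exact ENNReal.inv_mul_le_one _
  have := H (fun y => a⁻¹ * f y) (fun y => b⁻¹ * g y) (by fun_prop) (by fun_prop)
    (scale a f hf ha0 hat has) (scale b g hg hb0 hbt hbs)
  have e : ∀ x, TT N α (fun y => b⁻¹ * g y) x = b⁻¹ * TT N α g x := by
    intro x
    unfold TT
    simp_rw [mul_assoc]
    rw [lintegral_const_mul _ (by fun_prop)]
  have hT := TT_meas N α hg
  have e2 : ∫⁻ x, a⁻¹ * f x * TT N α (fun y => b⁻¹ * g y) x =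
      (a * b)⁻¹ * ∫⁻ x, f x * TT N α g x := by
    rw [← lintegral_const_mul _ (by fun_prop)]
    congr 1; ext x
    rw [e, ENNReal.mul_inv (Or.inl ha0) (Or.inl hat)]; ring
  rw [e2, mul_comm, ← div_eq_mul_inv, ENNReal.div_le_iff (mul_ne_zero ha0 hb0)
    (ENNReal.mul_ne_top hat hbt)] at this
  exact this

lemma fatou_le {X : Type*} [MeasurableSpace X] {μ : Measure X} {F : ℕ → X → ℝ≥0∞}
    {G : X → ℝ≥0∞} {B : ℝ≥0∞} (hF : ∀ n, Measurable (F n)) (hB : ∀ n, ∫⁻ x, F n x ∂μ ≤ B)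
    (h : ∀ᵐ x ∂μ, Tendsto (fun n => F n x) atTop (𝓝 (G x))) : ∫⁻ x, G x ∂μ ≤ B := by
  calc ∫⁻ x, G x ∂μ = ∫⁻ x, liminf (fun n => F n x) atTop ∂μ :=
        lintegral_congr_ae (h.mono fun x hx => hx.liminf_eq.symm)
    _ ≤ liminf (fun n => ∫⁻ x, F n x ∂μ) atTop := lintegral_liminf_le hF
    _ ≤ B := Filter.liminf_le_of_frequently_le' (Frequently.of_forall hB)

lemma duality (N : ℕ) {s q : ℝ} (hsq : s.HolderConjugate q) {h : Sp N → ℝ≥0∞}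
    (hh : Measurable h) {D : ℝ≥0∞} (hD : D ≠ ⊤)
    (H : ∀ g : Sp N → ℝ≥0∞, Measurable g → ∫⁻ x, g x * h x ≤ D * (∫⁻ x, g x ^ s) ^ (1 / s)) :
    ∫⁻ x, h x ^ q ≠ ⊤ := by
  have hq1 : 1 < q := hsq.symm.lt
  have hs1 : 1 < s := hsq.lt
  let hk : ℕ → Sp N → ℝ≥0∞ := fun k => (Metric.ball (0 : Sp N) k).indicator (fun x => min (h x) k)
  have hkm : ∀ k, Measurable (hk k) := fun k =>
    Measurable.indicator (by fun_prop) measurableSet_ball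
  have hkh : ∀ k x, hk k x ≤ h x := fun k x =>
    (Set.indicator_le_self _ _ _).trans (min_le_left _ _)
  have bound : ∀ k, ∫⁻ x, hk k x ^ q ≤ D ^ q := by
    intro k
    set I := ∫⁻ x, hk k x ^ q with hI
    have hIfin : I ≠ ⊤ := by
      have : I ≤ ∫⁻ x, (Metric.ball (0 : Sp N) k).indicator (fun _ => (k : ℝ≥0∞) ^ q) x := by
        apply lintegral_mono
        intro x
        by_cases hx : x ∈ Metric.ball (0 : Sp N) k
        · simp only [hk, Set.indicator_of_mem hx]
          gcongr
          exact min_le_right _ _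
        · simp only [hk, Set.indicator_of_notMem hx]
          rw [ENNReal.zero_rpow_of_pos (by linarith)]
      refine ne_top_of_le_ne_top ?_ this
      rw [lintegral_indicator measurableSet_ball, setLIntegral_const]
      exact ENNReal.mul_ne_top (ENNReal.rpow_ne_top_of_nonneg (by linarith) (by simp))
        measure_ball_lt_top.ne
    have h1 : I ≤ D * I ^ (1 / s) := by
      have := H (fun x => hk k x ^ (q - 1)) (by fun_prop)
      have e : ∀ x, (hk k x ^ (q - 1)) ^ s = hk k x ^ q := by
        intro x
        rw [← ENNReal.rpow_mul, hsq.symm.sub_one_mul_conj]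
      simp_rw [e] at this
      refine le_trans ?_ this
      apply lintegral_mono
      intro x
      dsimp only
      rw [← rpow_self_mul hq1.le, mul_comm]
      gcongr
      exact hkh k x
    rcases eq_or_ne I 0 with h0 | h0
    · rw [h0]; exact zero_le
    have h2 : I ^ (1 / q) ≤ D := by
      have e : I = I ^ (1 / q) * I ^ (1 / s) := by
        rw [← ENNReal.rpow_add _ _ h0 hIfin]
        have := hsq.symm.inv_add_inv_eq_one
        rw [one_div, one_div, this, ENNReal.rpow_one]
      have h1' : I ^ (1 / q) * I ^ (1 / s) ≤ D * I ^ (1 / s) := e.symm.le.trans h1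
      have p0 : I ^ (1 / s) ≠ 0 := by
        simp [h0, hIfin]
      have pt : I ^ (1 / s) ≠ ⊤ := ENNReal.rpow_ne_top_of_nonneg (by positivity) hIfin
      exact (ENNReal.mul_le_mul_iff_left p0 pt).1 h1'
    calc I = (I ^ (1 / q)) ^ q := by
          rw [← ENNReal.rpow_mul, one_div_mul_cancel (by linarith), ENNReal.rpow_one]
      _ ≤ D ^ q := by gcongr
  refine ne_top_of_le_ne_top (ENNReal.rpow_ne_top_of_nonneg (by linarith : (0:ℝ) ≤ q) hD)
    (fatou_le (fun k => (hkm k).pow_const q) bound (Eventually.of_forall fun x => ?_))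
  refine (ENNReal.continuous_rpow_const.tendsto _).comp ?_
  have t : Tendsto (fun k : ℕ => min (h x) (k : ℝ≥0∞)) atTop (𝓝 (h x)) := by
    have := (tendsto_const_nhds (x := h x) (f := atTop)).min ENNReal.tendsto_nat_nhds_top
    simpa using this
  refine t.congr' ?_
  obtain ⟨k0, hk0⟩ := exists_nat_gt ‖x‖
  filter_upwards [eventually_ge_atTop k0] with k hkk
  have : x ∈ Metric.ball (0 : Sp N) k := by
    rw [mem_ball_zero_iff]; exact hk0.trans_le (by exact_mod_cast hkk)
  simp only [hk, Set.indicator_of_mem this]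

lemma weak_conv {X : Type*} [MeasurableSpace X] {μ : Measure X} {s q : ℝ}
    (hsq : s.HolderConjugate q) {h : X → ℝ≥0∞} (hh : Measurable h) (hfin : ∫⁻ x, h x ^ q ∂μ ≠ ⊤)
    {g : ℕ → X → ℝ≥0∞} (hg : ∀ n, Measurable (g n)) {B : ℝ≥0∞} (hB : B ≠ ⊤)
    (hgB : ∀ n, ∫⁻ x, g n x ^ s ∂μ ≤ B)
    (hlim : ∀ᵐ x ∂μ, Tendsto (fun n => g n x) atTop (𝓝 0)) :
    Tendsto (fun n => ∫⁻ x, h x * g n x ∂μ) atTop (𝓝 0) := by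
  have hq1 : 1 < q := hsq.symm.lt
  have hs1 : 1 < s := hsq.lt
  have main : ∀ ε : ℝ≥0∞, ε ≠ 0 → ε ≠ ⊤ →
      ∀ᶠ n in atTop, ∫⁻ x, h x * g n x ∂μ ≤ ε + ε * B := by
    intro ε h0 ht
    let m : ℕ → X → ℝ≥0∞ := fun n x => h x * min (g n x) ((h x * ε⁻¹) ^ (q - 1))
    have hm : ∀ n, Measurable (m n) := by intro n; fun_prop
    have hD : Tendsto (fun n => ∫⁻ x, m n x ∂μ) atTop (𝓝 (∫⁻ x, 0 ∂μ)) := by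
      refine tendsto_lintegral_of_dominated_convergence
        (fun x => (ε⁻¹) ^ (q - 1) * h x ^ q) hm (fun n => Eventually.of_forall fun x => ?_) ?_ ?_
      · dsimp only [m]
        rw [← rpow_self_mul hq1.le (h x), mul_left_comm]
        gcongr
        refine (min_le_right _ _).trans (le_of_eq ?_)
        rw [ENNReal.mul_rpow_of_nonneg _ _ (by linarith), mul_comm]
      · rw [lintegral_const_mul _ (by fun_prop)]
        exact ENNReal.mul_ne_top (ENNReal.rpow_ne_top_of_nonneg (by linarith) (by simpa)) hfin
      · filter_upwards [hlim, ae_lt_top (hh.pow_const q) hfin] with x hx hx2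
        have hxt : h x ≠ ⊤ := by
          intro e; rw [e, ENNReal.top_rpow_of_pos (by linarith)] at hx2; simp at hx2
        have t1 : Tendsto (fun n => h x * g n x) atTop (𝓝 0) := by
          simpa using ENNReal.Tendsto.const_mul hx (Or.inr hxt)
        refine tendsto_of_tendsto_of_tendsto_of_le_of_le tendsto_const_nhds t1
          (fun n => zero_le) (fun n => ?_)
        dsimp only [m]
        gcongr
        exact min_le_left _ _
    rw [lintegral_zero] at hD
    filter_upwards [hD.eventually (Iic_mem_nhds (pos_iff_ne_zero.2 h0))] with n hn
    calc ∫⁻ x, h x * g n x ∂μ ≤ ∫⁻ x, (m n x + ε * g n x ^ s) ∂μ := by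
          apply lintegral_mono
          intro x
          dsimp only
          rcases le_total (h x) (ε * g n x ^ (s - 1)) with hx | hx
          · refine le_trans ?_ le_add_self
            rw [← rpow_self_mul hs1.le (g n x), mul_left_comm, mul_comm]
            gcongr
          · refine le_trans ?_ le_self_add
            dsimp only [m]
            gcongr
            refine le_min le_rfl ?_
            have : g n x ^ (s - 1) ≤ h x * ε⁻¹ := by
              rw [← div_eq_mul_inv, ENNReal.le_div_iff_mul_le (Or.inl h0) (Or.inl ht), mul_comm]
              exact hx
            calc g n x = (g n x ^ (s - 1)) ^ (q - 1) := by
                  rw [← ENNReal.rpow_mul]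
                  have : (s - 1) * (q - 1) = 1 := by
                    have := hsq.mul_eq_add
                    linarith
                  rw [this, ENNReal.rpow_one]
              _ ≤ _ := by gcongr
      _ = (∫⁻ x, m n x ∂μ) + ε * ∫⁻ x, g n x ^ s ∂μ := by
          rw [lintegral_add_left (hm n), lintegral_const_mul _ ((hg n).pow_const s)]
      _ ≤ ε + ε * B := by
          exact add_le_add hn (mul_le_mul_right (hgB n) _)
  rw [ENNReal.tendsto_nhds_zero]
  intro δ hδ
  rcases eq_or_ne δ ⊤ with rfl | hδt
  · simp
  have hB1 : (1 + B) ≠ ⊤ := by simp [hB]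
  have hB0 : (1 + B) ≠ 0 := by simp
  filter_upwards [main (δ / (1 + B)) (by simp [hδ.ne', hB]) (ENNReal.div_ne_top hδt hB0)] with n hn
  refine hn.trans (le_of_eq ?_)
  rw [show δ / (1 + B) + δ / (1 + B) * B = δ / (1 + B) * (1 + B) by ring]
  exact ENNReal.div_mul_cancel hB0 hB1
lemma TT_mono (N : ℕ) (α : ℝ) {f g : Sp N → ℝ≥0∞} (h : ∀ x, f x ≤ g x) (x : Sp N) :
    TT N α f x ≤ TT N α g x := by
  unfold TT
  apply lintegral_mono
  intro y
  exact mul_le_mul_left (h y) _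

lemma TT_add (N : ℕ) (α : ℝ) {f g : Sp N → ℝ≥0∞} (hf : Measurable f) (x : Sp N) :
    TT N α (fun y => f y + g y) x = TT N α f x + TT N α g x := by
  have := KK_meas N α
  unfold TT
  simp_rw [add_mul]
  rw [lintegral_add_left (by fun_prop)]

lemma TT_symm (N : ℕ) (α : ℝ) {f g : Sp N → ℝ≥0∞} (hf : Measurable f) (hg : Measurable g) :
    ∫⁻ x, f x * TT N α g x = ∫⁻ x, TT N α f x * g x := by
  have := KK_meas N α
  have e1 : ∀ x, f x * TT N α g x = ∫⁻ y, f x * (g y * KK N α (x - y)) := fun x => by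
    rw [lintegral_const_mul _ (by fun_prop)]; rfl
  have e2 : ∀ y, TT N α f y * g y = ∫⁻ x, f x * (g y * KK N α (x - y)) := fun y => by
    unfold TT
    rw [← lintegral_mul_const _ (by fun_prop)]
    congr 1; ext x
    rw [KK_sub_comm]; ring
  simp_rw [e1, e2]
  rw [lintegral_lintegral_swap]
  exact Measurable.aemeasurable (by
    unfold Function.uncurry
    fun_prop)

lemma TT_Lq (N : ℕ) (hN : 3 ≤ N) (α : ℝ) (hα : α ∈ Set.Ioo (0 : ℝ) (N : ℝ)) {f : Sp N → ℝ≥0∞}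
    (hf : Measurable f) (hfin : ∫⁻ y, f y ^ (2 * N / ((N : ℝ) + α)) ≠ ⊤) :
    ∫⁻ x, TT N α f x ^ (2 * N / ((N : ℝ) - α)) ≠ ⊤ := by
  have hc := hold_conj N hN α hα
  obtain ⟨C, hC, H⟩ := hls N hN α hα
  have hs1 := hc.lt
  refine duality N hc (TT_meas N α hf)
    (D := C * (∫⁻ y, f y ^ (2 * N / ((N : ℝ) + α))) ^ (1 / (2 * N / ((N : ℝ) + α))))
    (ENNReal.mul_ne_top hC (ENNReal.rpow_ne_top_of_nonneg (by positivity) hfin)) ?_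
  intro g hg
  refine (H g f hg hf).trans (le_of_eq ?_)
  ring

lemma TT_fin (N : ℕ) (hN : 3 ≤ N) (α : ℝ) (hα : α ∈ Set.Ioo (0 : ℝ) (N : ℝ)) {f : Sp N → ℝ≥0∞}
    (hf : Measurable f) (hfin : ∫⁻ y, f y ^ (2 * N / ((N : ℝ) + α)) ≠ ⊤) :
    ∀ᵐ x, TT N α f x ≠ ⊤ := by
  have hq := (hold_conj N hN α hα).symm.pos
  filter_upwards [ae_lt_top ((TT_meas N α hf).pow_const _) (TT_Lq N hN α hα hf hfin)] with x hx e
  rw [e, ENNReal.top_rpow_of_pos hq] at hx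
  simp at hx

lemma riesz_eq (N : ℕ) (α : ℝ) {f : Sp N → ℝ} (hf : Measurable f) (h0 : ∀ x, 0 ≤ f x) (x : Sp N) :
    riesz N α f x = (TT N α (fun y => ENNReal.ofReal (f y)) x).toReal := by
  unfold riesz TT KK
  rw [integral_eq_lintegral_of_nonneg_ae]
  · congr 2; ext y; rw [ENNReal.ofReal_mul (h0 y)]
  · exact Eventually.of_forall fun y => mul_nonneg (h0 y) (by positivity)
  · exact Measurable.aestronglyMeasurable (by fun_prop)

/-- Elementary inequality of Brezis–Lieb. -/
lemma elem_ineq (p : ℝ) (hp : 1 ≤ p) (ε : ℝ) (hε : 0 < ε) :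
    ∃ C : ℝ, 0 ≤ C ∧ ∀ a b : ℝ, |(|a + b| ^ p - |a| ^ p - |b| ^ p)| ≤ ε * |a| ^ p + C * |b| ^ p := by
  have hcont : Tendsto (fun t : ℝ => t ^ p) (𝓝 1) (𝓝 1) := by
    have := (Real.continuousAt_rpow_const 1 p (Or.inl one_ne_zero)).tendsto
    simpa using this
  obtain ⟨δ, hδ, H⟩ := Metric.tendsto_nhds_nhds.1 hcont ε hε
  refine ⟨(1 + 2 / δ) ^ p + (2 / δ) ^ p + 1, by positivity, fun a b => ?_⟩
  have hp0 : 0 ≤ p := by linarith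
  have hbp : 0 ≤ |b| ^ p := by positivity
  have hap : 0 ≤ |a| ^ p := by positivity
  have tri : |(|a + b| ^ p - |a| ^ p - |b| ^ p)| ≤ |(|a + b| ^ p - |a| ^ p)| + |b| ^ p := by
    calc _ ≤ |(|a + b| ^ p - |a| ^ p)| + |(|b| ^ p)| := abs_sub _ _
      _ = _ := by rw [abs_of_nonneg hbp]
  refine tri.trans ?_
  have hc1 : 0 ≤ (1 + 2 / δ) ^ p := by positivity
  have hc2 : 0 ≤ (2 / δ) ^ p := by positivity
  by_cases hab : 2 * |b| ≤ δ * |a| ∧ a ≠ 0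
  · obtain ⟨hab, ha⟩ := hab
    have ha' : 0 < |a| := abs_pos.2 ha
    have ht : dist (|a + b| / |a|) 1 < δ := by
      rw [Real.dist_eq, div_sub_one ha'.ne', abs_div, abs_abs, div_lt_iff₀ ha']
      have h1 : |(|a + b| - |a|)| ≤ |b| := by
        have := abs_abs_sub_abs_le (a + b) a
        simpa using this
      have : 0 < δ * |a| := by positivity
      linarith
    have h2 := H ht
    rw [Real.dist_eq, Real.div_rpow (abs_nonneg _) (abs_nonneg _)] at h2
    have hapos : 0 < |a| ^ p := by positivity
    have h3 : |(|a + b| ^ p - |a| ^ p)| ≤ ε * |a| ^ p := by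
      rw [div_sub_one hapos.ne', abs_div, abs_of_pos hapos, div_lt_iff₀ hapos] at h2
      exact h2.le
    nlinarith [mul_nonneg hc1 hbp, mul_nonneg hc2 hbp]
  · have ha : |a| ≤ 2 / δ * |b| := by
      by_cases h : a = 0
      · rw [h, abs_zero]; positivity
      · have : ¬ 2 * |b| ≤ δ * |a| := fun h' => hab ⟨h', h⟩
        push Not at this
        rw [div_mul_eq_mul_div, le_div_iff₀ hδ]; linarith
    have h1 : |a + b| ^ p ≤ (1 + 2 / δ) ^ p * |b| ^ p := by
      rw [← Real.mul_rpow (by positivity) (by positivity)]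
      gcongr
      have := abs_add_le a b
      linarith
    have h2 : |a| ^ p ≤ (2 / δ) ^ p * |b| ^ p := by
      rw [← Real.mul_rpow (by positivity) (by positivity)]
      gcongr
    have h3 : |(|a + b| ^ p - |a| ^ p)| ≤ |a + b| ^ p + |a| ^ p := by
      have : 0 ≤ |a + b| ^ p := by positivity
      rw [abs_le]; constructor <;> linarith
    nlinarith [mul_nonneg hε.le hap]

/-- Brezis–Lieb type convergence in `L^s` of the remainder. -/
lemma remainder_conv (N : ℕ) {s p : ℝ} (hs : 1 < s) (hp : 1 ≤ p) (u : ℕ → Sp N → ℝ)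
    (v : Sp N → ℝ) (hu : ∀ n, Measurable (u n)) (hv : Measurable v) {B : ℝ≥0∞} (hB : B ≠ ⊤)
    (hvB : ∫⁻ x, ENNReal.ofReal (|v x| ^ p) ^ s ≠ ⊤)
    (hgB : ∀ n, ∫⁻ x, ENNReal.ofReal (|u n x - v x| ^ p) ^ s ≤ B)
    (hlim : ∀ᵐ x, Tendsto (fun n => u n x) atTop (𝓝 (v x))) :
    Tendsto (fun n => ∫⁻ x,
      ENNReal.ofReal |(|u n x| ^ p - |u n x - v x| ^ p - |v x| ^ p)| ^ s) atTop (𝓝 0) := by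
  have hs0 : 0 < s := by linarith
  have hp0 : 0 < p := by linarith
  set r : ℕ → Sp N → ℝ≥0∞ := fun n x =>
    ENNReal.ofReal |(|u n x| ^ p - |u n x - v x| ^ p - |v x| ^ p)| with hr
  set G : ℕ → Sp N → ℝ≥0∞ := fun n x => ENNReal.ofReal (|u n x - v x| ^ p) with hG
  have hrm : ∀ n, Measurable (r n) := by
    intro n; have := hu n; simp only [hr, ← Real.norm_eq_abs]; fun_prop
  have hGm : ∀ n, Measurable (G n) := by
    intro n; have := hu n; simp only [hG, ← Real.norm_eq_abs]; fun_prop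
  have hrlim : ∀ᵐ x, Tendsto (fun n => r n x) atTop (𝓝 0) := by
    filter_upwards [hlim] with x hx
    have hc : Continuous (fun t : ℝ =>
        ENNReal.ofReal |(|t| ^ p - |t - v x| ^ p - |v x| ^ p)|) := by
      have h1 : Continuous (fun t : ℝ => |t| ^ p) :=
        continuous_abs.rpow_const (fun _ => Or.inr hp0.le)
      have h2 : Continuous (fun t : ℝ => |t - v x| ^ p) :=
        h1.comp (continuous_id.sub continuous_const)
      exact ENNReal.continuous_ofReal.comp (continuous_abs.comp
        ((h1.sub h2).sub continuous_const))
    have := (hc.tendsto (v x)).comp hx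
    simpa [Real.zero_rpow hp0.ne', Function.comp_def, hr] using this
  have main : ∀ ε : ℝ≥0∞, ε ≠ 0 → ε ≤ 1 →
      ∀ᶠ n in atTop, ∫⁻ x, r n x ^ s ≤ ε * (2 ^ (s - 1) * (1 + B)) := by
    intro ε h0 h1
    have ht : ε ≠ ⊤ := ne_top_of_le_ne_top ENNReal.one_ne_top h1
    obtain ⟨C, hC0, hC⟩ := elem_ineq p hp ε.toReal (ENNReal.toReal_pos h0 ht)
    have hle : ∀ n x, r n x ≤ ε * G n x + ENNReal.ofReal C * ENNReal.ofReal (|v x| ^ p) := by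
      intro n x
      have := hC (u n x - v x) (v x)
      rw [sub_add_cancel] at this
      refine (ENNReal.ofReal_le_ofReal this).trans (le_of_eq ?_)
      rw [ENNReal.ofReal_add (by positivity) (by positivity), ENNReal.ofReal_mul (by positivity),
        ENNReal.ofReal_mul hC0, ENNReal.ofReal_toReal ht]
    have hD : Tendsto (fun n => ∫⁻ x, (r n x - ε * G n x) ^ s) atTop
        (𝓝 (∫⁻ _ : Sp N, 0)) := by
      refine tendsto_lintegral_of_dominated_convergence
        (fun x => ENNReal.ofReal C ^ s * ENNReal.ofReal (|v x| ^ p) ^ s) ?_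
        (fun n => Eventually.of_forall fun x => ?_) ?_ ?_
      · intro n; have := hrm n; have := hGm n; fun_prop
      · dsimp only
        rw [← ENNReal.mul_rpow_of_nonneg _ _ hs0.le]
        gcongr
        rw [tsub_le_iff_left]
        exact hle n x
      · rw [lintegral_const_mul _ (by simp only [← Real.norm_eq_abs]; fun_prop)]
        exact ENNReal.mul_ne_top (ENNReal.rpow_ne_top_of_nonneg hs0.le ENNReal.ofReal_ne_top) hvB
      · filter_upwards [hrlim] with x hx
        have t : Tendsto (fun n => r n x ^ s) atTop (𝓝 0) := by
          have := (ENNReal.continuous_rpow_const (y := s)).tendsto 0 |>.comp hx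
          simpa [ENNReal.zero_rpow_of_pos hs0, Function.comp_def] using this
        refine tendsto_of_tendsto_of_tendsto_of_le_of_le tendsto_const_nhds t
          (fun n => zero_le) (fun n => ?_)
        dsimp only
        gcongr
        exact tsub_le_self
    rw [lintegral_zero] at hD
    filter_upwards [hD.eventually (Iic_mem_nhds (pos_iff_ne_zero.2 h0))] with n hn
    have hεs : ε ^ s ≤ ε := by
      have := ENNReal.rpow_le_rpow_of_exponent_ge h1 hs.le
      simpa using this
    have := hrm n
    have := hGm n
    calc ∫⁻ x, r n x ^ s ≤ ∫⁻ x, 2 ^ (s - 1) * ((r n x - ε * G n x) ^ s + ε ^ s * G n x ^ s) := by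
          apply lintegral_mono
          intro x
          dsimp only
          rw [← ENNReal.mul_rpow_of_nonneg _ _ hs0.le]
          refine le_trans ?_ (ENNReal.rpow_add_le_mul_rpow_add_rpow _ _ hs.le)
          gcongr
          exact le_tsub_add
      _ = 2 ^ (s - 1) * ((∫⁻ x, (r n x - ε * G n x) ^ s) + ε ^ s * ∫⁻ x, G n x ^ s) := by
          rw [lintegral_const_mul _ (by fun_prop), lintegral_add_left (by fun_prop),
            lintegral_const_mul _ (by fun_prop)]
      _ ≤ 2 ^ (s - 1) * (ε + ε * B) :=
          mul_le_mul_right (add_le_add hn (mul_le_mul' hεs (hgB n))) _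
      _ = _ := by ring
  have hκ : (2:ℝ≥0∞) ^ (s - 1) * (1 + B) ≠ ⊤ :=
    ENNReal.mul_ne_top (ENNReal.rpow_ne_top_of_nonneg (by linarith) (by simp)) (by simp [hB])
  have hκ0 : (2:ℝ≥0∞) ^ (s - 1) * (1 + B) ≠ 0 := by
    refine mul_ne_zero ?_ (by simp)
    exact (ENNReal.rpow_pos (by simp) (by simp)).ne'
  rw [ENNReal.tendsto_nhds_zero]
  intro δ hδ
  filter_upwards [main (min 1 (δ / (2 ^ (s - 1) * (1 + B))))
    (by simpa using ⟨hδ.ne', hκ⟩) (min_le_left _ _)] with n hn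
  refine hn.trans ?_
  calc _ ≤ δ / (2 ^ (s - 1) * (1 + B)) * (2 ^ (s - 1) * (1 + B)) :=
        mul_le_mul_left (min_le_right _ _) _
    _ = δ := ENNReal.div_mul_cancel hκ0 hκ
lemma real_bound {A B C ρ a b c ρ0 : ℝ} (hA : 0 ≤ A) (hB : 0 ≤ B) (hC : 0 ≤ C)
    (hb : 0 ≤ b) (hc : 0 ≤ c) (h1 : |A - B - C| ≤ ρ) (h2 : |a - b - c| ≤ ρ0) :
    |A * a - B * b - C * c| ≤ C * b + c * B + b * ρ + c * ρ + ρ0 * A := by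
  have e : A * a - B * b - C * c =
      (C * b + c * B) + b * (A - B - C) + c * (A - B - C) + (a - b - c) * A := by ring
  rw [e]
  have t1 : |b * (A - B - C)| ≤ b * ρ := by rw [abs_mul, abs_of_nonneg hb]; gcongr
  have t2 : |c * (A - B - C)| ≤ c * ρ := by rw [abs_mul, abs_of_nonneg hc]; gcongr
  have t3 : |(a - b - c) * A| ≤ ρ0 * A := by rw [abs_mul, abs_of_nonneg hA]; gcongr
  have t4 : |C * b + c * B| = C * b + c * B := abs_of_nonneg (by positivity)
  refine (abs_add_le _ _).trans (add_le_add ((abs_add_le _ _).trans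
    (add_le_add ((abs_add_le _ _).trans (add_le_add t4.le t1)) t2)) t3)

lemma main_meas
    (N : ℕ) (hN : 3 ≤ N) (α p : ℝ) (hα : α ∈ Set.Ioo (0 : ℝ) (N : ℝ))
    (hp1 : 1 ≤ p)
    (u : ℕ → Sp N → ℝ) (v : Sp N → ℝ)
    (hu : ∀ n, Measurable (u n)) (hv : Measurable v)
    (hbdd : ∃ C : ℝ≥0∞, C < ⊤ ∧
      ∀ n, eLpNorm (u n) (ENNReal.ofReal (2 * N * p / ((N : ℝ) + α))) volume ≤ C)
    (hae : ∀ᵐ x ∂(volume : Measure (Sp N)), Tendsto (fun n => u n x) atTop (nhds (v x))) :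
    Tendsto
      (fun n => ∫ x,
        |riesz N α (fun y => |u n y| ^ p) x * |u n x| ^ p
          - riesz N α (fun y => |u n y - v y| ^ p) x * |u n x - v x| ^ p
          - riesz N α (fun y => |v y| ^ p) x * |v x| ^ p|)
      atTop (nhds 0) := by
  have hconj := hold_conj N hN α hα
  have hs1 := hconj.lt
  obtain ⟨C, hC, HLS⟩ := hls N hN α hα
  have hLq := fun f => @TT_Lq N hN α hα f
  have hfin := fun f => @TT_fin N hN α hα f
  rw [show 2 * N * p / ((N : ℝ) + α) = p * (2 * N / ((N : ℝ) + α)) by ring] at hbdd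
  set s : ℝ := 2 * N / ((N : ℝ) + α) with hs
  have hs0 : 0 < s := by linarith
  have hp0 : 0 < p := by linarith
  have hps : 1 ≤ p * s := by nlinarith
  have hps0 : 0 < p * s := by linarith
  have hof : ∀ t : ℝ, ENNReal.ofReal (|t| ^ p) ^ s = ‖t‖ₑ ^ (p * s) := by
    intro t
    rw [← ENNReal.ofReal_rpow_of_nonneg (abs_nonneg t) hp0.le, ← ENNReal.rpow_mul,
      Real.enorm_eq_ofReal_abs]
  set F : ℕ → Sp N → ℝ≥0∞ := fun n x => ENNReal.ofReal (|u n x| ^ p) with hF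
  set G : ℕ → Sp N → ℝ≥0∞ := fun n x => ENNReal.ofReal (|u n x - v x| ^ p) with hG
  set V : Sp N → ℝ≥0∞ := fun x => ENNReal.ofReal (|v x| ^ p) with hV
  set r : ℕ → Sp N → ℝ≥0∞ := fun n x =>
    ENNReal.ofReal |(|u n x| ^ p - |u n x - v x| ^ p - |v x| ^ p)| with hr
  have hum' : ∀ n, Measurable (fun x => |u n x| ^ p) := by
    intro n; have := hu n; simp only [← Real.norm_eq_abs]; fun_prop
  have hgm' : ∀ n, Measurable (fun x => |u n x - v x| ^ p) := by
    intro n; have := hu n; simp only [← Real.norm_eq_abs]; fun_prop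
  have hvm' : Measurable (fun x => |v x| ^ p) := by
    simp only [← Real.norm_eq_abs]; fun_prop
  have hrm' : ∀ n, Measurable (fun x => |(|u n x| ^ p - |u n x - v x| ^ p - |v x| ^ p)|) := by
    intro n; have := hu n; simp only [← Real.norm_eq_abs]; fun_prop
  have hFm : ∀ n, Measurable (F n) := fun n => (hum' n).ennreal_ofReal
  have hGm : ∀ n, Measurable (G n) := fun n => (hgm' n).ennreal_ofReal
  have hVm : Measurable V := hvm'.ennreal_ofReal
  have hrm : ∀ n, Measurable (r n) := fun n => (hrm' n).ennreal_ofReal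
  -- uniform bounds
  obtain ⟨B, hB, hFB⟩ : ∃ B : ℝ≥0∞, B ≠ ⊤ ∧ ∀ n, ∫⁻ x, F n x ^ s ≤ B := by
    obtain ⟨C, hC, H⟩ := hbdd
    refine ⟨C ^ (p * s), ENNReal.rpow_ne_top_of_nonneg hps0.le hC.ne, fun n => ?_⟩
    have := H n
    rw [eLpNorm_eq_lintegral_rpow_enorm_toReal (by simpa using hps0) (by simp),
      ENNReal.toReal_ofReal hps0.le] at this
    have h2 := ENNReal.rpow_le_rpow this hps0.le
    rw [← ENNReal.rpow_mul, one_div_mul_cancel hps0.ne', ENNReal.rpow_one] at h2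
    refine le_trans (le_of_eq ?_) h2
    congr 1; ext x; exact hof _
  have hVB : ∫⁻ x, V x ^ s ≤ B := by
    refine fatou_le (fun n => (hFm n).pow_const s) hFB ?_
    filter_upwards [hae] with x hx
    have hc : Continuous (fun t : ℝ => ENNReal.ofReal (|t| ^ p) ^ s) :=
      ENNReal.continuous_rpow_const.comp (ENNReal.continuous_ofReal.comp
        (continuous_abs.rpow_const (fun _ => Or.inr hp0.le)))
    exact (hc.tendsto (v x)).comp hx
  obtain ⟨B', hB', hGB⟩ : ∃ B' : ℝ≥0∞, B' ≠ ⊤ ∧ ∀ n, ∫⁻ x, G n x ^ s ≤ B' := by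
    refine ⟨2 ^ (p * s - 1) * (B + B), ENNReal.mul_ne_top
      (ENNReal.rpow_ne_top_of_nonneg (by linarith) (by simp)) (by simp [hB]), fun n => ?_⟩
    calc ∫⁻ x, G n x ^ s ≤ ∫⁻ x, 2 ^ (p * s - 1) * (F n x ^ s + V x ^ s) := by
          apply lintegral_mono
          intro x
          simp only [hG, hF, hV, hof]
          refine le_trans ?_ (ENNReal.rpow_add_le_mul_rpow_add_rpow _ _ hps)
          gcongr
          exact enorm_sub_le
      _ = 2 ^ (p * s - 1) * ((∫⁻ x, F n x ^ s) + ∫⁻ x, V x ^ s) := by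
          have := hFm n
          rw [lintegral_const_mul _ (by fun_prop), lintegral_add_left (by fun_prop)]
      _ ≤ _ := mul_le_mul_right (add_le_add (hFB n) hVB) _
  have hVt : ∫⁻ x, V x ^ s ≠ ⊤ := ne_top_of_le_ne_top hB hVB
  have hrlim : Tendsto (fun n => ∫⁻ x, r n x ^ s) atTop (𝓝 0) :=
    remainder_conv N hs1 hp1 u v hu hv hB' hVt hGB hae
  have hρlim : Tendsto (fun n => (∫⁻ x, r n x ^ s) ^ (1 / s)) atTop (𝓝 0) := by
    have := ((ENNReal.continuous_rpow_const (y := 1 / s)).tendsto 0).comp hrlim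
    simpa [Function.comp_def, ENNReal.zero_rpow_of_pos (inv_pos.2 hs0)] using this
  -- the five terms
  have hGlim : ∀ᵐ x, Tendsto (fun n => G n x) atTop (𝓝 0) := by
    filter_upwards [hae] with x hx
    have hc : Continuous (fun t : ℝ => ENNReal.ofReal (|t - v x| ^ p)) :=
      ENNReal.continuous_ofReal.comp ((continuous_abs.comp
        (continuous_id.sub continuous_const)).rpow_const (fun _ => Or.inr hp0.le))
    have := (hc.tendsto (v x)).comp hx
    simpa [Real.zero_rpow hp0.ne', Function.comp_def, hG] using this
  have T1 : Tendsto (fun n => ∫⁻ x, TT N α V x * G n x) atTop (𝓝 0) :=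
    weak_conv hconj (TT_meas N α hVm) (hLq V hVm hVt) hGm hB' hGB hGlim
  have T2 : Tendsto (fun n => ∫⁻ x, V x * TT N α (G n) x) atTop (𝓝 0) := by
    refine T1.congr fun n => ?_
    rw [TT_symm N α hVm (hGm n)]
  have small : ∀ b : ℝ≥0∞, b ≠ ⊤ →
      Tendsto (fun n => C * (b ^ (1 / s) * (∫⁻ x, r n x ^ s) ^ (1 / s))) atTop (𝓝 0) := by
    intro b hb
    have hb' : b ^ (1 / s) ≠ ⊤ := ENNReal.rpow_ne_top_of_nonneg (by positivity) hb
    have := ENNReal.Tendsto.const_mul (a := C)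
      (ENNReal.Tendsto.const_mul (a := b ^ (1 / s)) hρlim (Or.inr hb')) (Or.inr hC)
    simpa using this
  have T3 : Tendsto (fun n => ∫⁻ x, G n x * TT N α (r n) x) atTop (𝓝 0) := by
    refine tendsto_of_tendsto_of_tendsto_of_le_of_le tendsto_const_nhds (small B' hB')
      (fun n => zero_le) (fun n => (HLS _ _ (hGm n) (hrm n)).trans ?_)
    gcongr
    exact hGB n
  have T4 : Tendsto (fun n => ∫⁻ x, V x * TT N α (r n) x) atTop (𝓝 0) := by
    refine tendsto_of_tendsto_of_tendsto_of_le_of_le tendsto_const_nhds (small B hB)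
      (fun n => zero_le) (fun n => (HLS _ _ hVm (hrm n)).trans ?_)
    gcongr
  have T5 : Tendsto (fun n => ∫⁻ x, r n x * TT N α (F n) x) atTop (𝓝 0) := by
    refine tendsto_of_tendsto_of_tendsto_of_le_of_le tendsto_const_nhds (small B hB)
      (fun n => zero_le) (fun n => (HLS _ _ (hrm n) (hFm n)).trans ?_)
    rw [mul_comm ((∫⁻ x, r n x ^ s) ^ (1 / s)) _]
    gcongr
    exact hFB n
  have Tsum := ((((T1.add T2).add T3).add T4).add T5)
  simp only [add_zero] at Tsum
  -- pointwise bound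
  have hmain : ∀ n, ∫⁻ x, ‖|riesz N α (fun y => |u n y| ^ p) x * |u n x| ^ p
          - riesz N α (fun y => |u n y - v y| ^ p) x * |u n x - v x| ^ p
          - riesz N α (fun y => |v y| ^ p) x * |v x| ^ p|‖ₑ ≤
      (∫⁻ x, TT N α V x * G n x) + (∫⁻ x, V x * TT N α (G n) x)
        + (∫⁻ x, G n x * TT N α (r n) x) + (∫⁻ x, V x * TT N α (r n) x)
        + ∫⁻ x, r n x * TT N α (F n) x := by
    intro n
    have m1 := TT_meas N α hVm
    have m2 := TT_meas N α (hGm n)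
    have m3 := TT_meas N α (hrm n)
    have m4 := TT_meas N α (hFm n)
    have m5 := hGm n
    have m6 := hrm n
    rw [← lintegral_add_left (by fun_prop), ← lintegral_add_left (by fun_prop),
      ← lintegral_add_left (by fun_prop), ← lintegral_add_left (by fun_prop)]
    apply lintegral_mono_ae
    filter_upwards [hfin (F n) (hFm n) (ne_top_of_le_ne_top hB (hFB n)),
      hfin (G n) (hGm n) (ne_top_of_le_ne_top hB' (hGB n)), hfin V hVm hVt] with x xF xG xV
    rw [riesz_eq N α (hum' n) (fun _ => by positivity),
      riesz_eq N α (hgm' n) (fun _ => by positivity),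
      riesz_eq N α hvm' (fun _ => by positivity)]
    change ‖|(TT N α (F n) x).toReal * |u n x| ^ p - (TT N α (G n) x).toReal * |u n x - v x| ^ p
      - (TT N α V x).toReal * |v x| ^ p|‖ₑ ≤ _
    have q1 : ∀ y, F n y ≤ G n y + V y + r n y := by
      intro y
      simp only [hF, hG, hV, hr]
      rw [← ENNReal.ofReal_add (by positivity) (by positivity),
        ← ENNReal.ofReal_add (by positivity) (by positivity)]
      apply ENNReal.ofReal_le_ofReal
      have := le_abs_self (|u n y| ^ p - |u n y - v y| ^ p - |v y| ^ p)
      linarith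
    have q2 : ∀ y, G n y + V y ≤ F n y + r n y := by
      intro y
      simp only [hF, hG, hV, hr]
      rw [← ENNReal.ofReal_add (by positivity) (by positivity),
        ← ENNReal.ofReal_add (by positivity) (by positivity)]
      apply ENNReal.ofReal_le_ofReal
      have := neg_abs_le (|u n y| ^ p - |u n y - v y| ^ p - |v y| ^ p)
      linarith
    have q3 : ∀ y, r n y ≤ F n y + G n y + V y := by
      intro y
      simp only [hF, hG, hV, hr]
      rw [← ENNReal.ofReal_add (by positivity) (by positivity),
        ← ENNReal.ofReal_add (by positivity) (by positivity)]
      apply ENNReal.ofReal_le_ofReal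
      have a1 : 0 ≤ |u n y| ^ p := by positivity
      have a2 : 0 ≤ |u n y - v y| ^ p := by positivity
      have a3 : 0 ≤ |v y| ^ p := by positivity
      rw [abs_le]; constructor <;> linarith
    have w1 := TT_mono N α q1 x
    have w2 := TT_mono N α q2 x
    have w3 := TT_mono N α q3 x
    rw [TT_add N α (by fun_prop), TT_add N α (hGm n)] at w1
    rw [TT_add N α (hGm n), TT_add N α (hFm n)] at w2
    have m7 := hFm n
    rw [TT_add N α (by fun_prop), TT_add N α (hFm n)] at w3
    have xr : TT N α (r n) x ≠ ⊤ := ne_top_of_le_ne_top (by simp [xF, xG, xV]) w3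
    have w1' := ENNReal.toReal_mono (by simp [xr, xG, xV]) w1
    have w2' := ENNReal.toReal_mono (by simp [xF, xr]) w2
    rw [ENNReal.toReal_add (by simp [xG, xV]) xr, ENNReal.toReal_add xG xV] at w1'
    rw [ENNReal.toReal_add xG xV, ENNReal.toReal_add xF xr] at w2'
    rw [Real.enorm_eq_ofReal_abs, abs_abs]
    have rb := real_bound (A := (TT N α (F n) x).toReal) (B := (TT N α (G n) x).toReal)
      (C := (TT N α V x).toReal) (ρ := (TT N α (r n) x).toReal) (a := |u n x| ^ p)
      (b := |u n x - v x| ^ p) (c := |v x| ^ p) ENNReal.toReal_nonneg ENNReal.toReal_nonneg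
      ENNReal.toReal_nonneg (by positivity) (by positivity)
      (by rw [abs_le]; constructor <;> linarith) le_rfl
    refine (ENNReal.ofReal_le_ofReal rb).trans (le_of_eq ?_)
    rw [ENNReal.ofReal_add (by positivity) (by positivity),
      ENNReal.ofReal_add (by positivity) (by positivity),
      ENNReal.ofReal_add (by positivity) (by positivity),
      ENNReal.ofReal_add (by positivity) (by positivity),
      ENNReal.ofReal_mul (by positivity), ENNReal.ofReal_mul (by positivity),
      ENNReal.ofReal_mul (by positivity), ENNReal.ofReal_mul (by positivity),
      ENNReal.ofReal_mul (by positivity), ENNReal.ofReal_toReal xF, ENNReal.ofReal_toReal xG,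
      ENNReal.ofReal_toReal xV, ENNReal.ofReal_toReal xr]
  rw [tendsto_zero_iff_enorm_tendsto_zero]
  exact tendsto_of_tendsto_of_tendsto_of_le_of_le tendsto_const_nhds Tsum
    (fun n => zero_le) (fun n => (enorm_integral_le_lintegral_enorm _).trans (hmain n))

/-- Nonlocal Brezis–Lieb lemma. -/
theorem nonlocal_brezis_lieb
    (N : ℕ) (hN : 3 ≤ N) (α p : ℝ) (hα : α ∈ Set.Ioo (0 : ℝ) (N : ℝ))
    (hp1 : 1 ≤ p) (hp2 : p < 2 * N / ((N : ℝ) + α))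
    (u : ℕ → Sp N → ℝ) (ulim : Sp N → ℝ)
    (hmeas : ∀ n, AEStronglyMeasurable (u n) (volume : Measure (Sp N)))
    (hbdd : ∃ C : ℝ≥0∞, C < ⊤ ∧
      ∀ n, eLpNorm (u n) (ENNReal.ofReal (2 * N * p / ((N : ℝ) + α))) volume ≤ C)
    (hae : ∀ᵐ x ∂(volume : Measure (Sp N)), Tendsto (fun n => u n x) atTop (nhds (ulim x))) :
    Tendsto
      (fun n => ∫ x,
        |riesz N α (fun y => |u n y| ^ p) x * |u n x| ^ p
          - riesz N α (fun y => |u n y - ulim y| ^ p) x * |u n x - ulim x| ^ p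
          - riesz N α (fun y => |ulim y| ^ p) x * |ulim x| ^ p|)
      atTop (nhds 0) := by
  have hv : AEStronglyMeasurable ulim (volume : Measure (Sp N)) :=
    aestronglyMeasurable_of_tendsto_ae atTop hmeas hae
  have eu : ∀ n, u n =ᵐ[volume] (hmeas n).mk (u n) := fun n => (hmeas n).ae_eq_mk
  have ev : ulim =ᵐ[volume] hv.mk ulim := hv.ae_eq_mk
  have key := main_meas N hN α p hα hp1 (fun n => (hmeas n).mk (u n)) (hv.mk ulim)
    (fun n => (hmeas n).stronglyMeasurable_mk.measurable) hv.stronglyMeasurable_mk.measurable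
    (by
      obtain ⟨C, hC, H⟩ := hbdd
      exact ⟨C, hC, fun n => (eLpNorm_congr_ae (eu n)).symm.le.trans (H n)⟩)
    (by
      filter_upwards [hae, ev, ae_all_iff.2 eu] with x hx h1 h2
      rw [← h1]
      exact hx.congr h2)
  have rc : ∀ f g : Sp N → ℝ, f =ᵐ[volume] g → ∀ x, riesz N α f x = riesz N α g x := by
    intro f g h x
    unfold riesz
    apply integral_congr_ae
    filter_upwards [h] with y hy
    rw [hy]
  refine key.congr fun n => ?_
  apply integral_congr_ae
  filter_upwards [ev, eu n] with x h1 h2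
  rw [← h1, ← h2,
    rc (fun y => |(hmeas n).mk (u n) y| ^ p) (fun y => |u n y| ^ p)
      (by filter_upwards [eu n] with y hy; rw [hy]) x,
    rc (fun y => |(hmeas n).mk (u n) y - hv.mk ulim y| ^ p) (fun y => |u n y - ulim y| ^ p)
      (by filter_upwards [eu n, ev] with y hy hy2; rw [hy, hy2]) x,
    rc (fun y => |hv.mk ulim y| ^ p) (fun y => |ulim y| ^ p)
      (by filter_upwards [ev] with y hy; rw [hy]) x]
end
end

section
/- Assume p > q > 1, λ > 0, that p and q satisfy (N+α)/N < p < (N+α)/(N−2s) and (N+β)/N < q < (N+β)/(N−2s), and that V satisfies (V1). Then there exists a constant C₀ > 0 such that ‖u‖ ≥ C₀ for every u in the Nehari manifold N_λ. -/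
open MeasureTheory Real Filter Topology

noncomputable section

/-- Square of the Gagliardo seminorm `[u]²`. -/
noncomputable def gagSq (N : ℕ) (s : ℝ) (u : Sp N → ℝ) : ℝ :=
  ∫ z : Sp N × Sp N, (u z.1 - u z.2) ^ 2 * ‖z.1 - z.2‖ ^ (-(N : ℝ) - 2 * s)

/-- Membership in the space `X = X_V^s(ℝ^N)`. -/
def memX (N : ℕ) (s : ℝ) (V : Sp N → ℝ) (u : Sp N → ℝ) : Prop :=
  Measurable u ∧
  Integrable (fun z : Sp N × Sp N => (u z.1 - u z.2) ^ 2 * ‖z.1 - z.2‖ ^ (-(N : ℝ) - 2 * s)) ∧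
  Integrable (fun x => V x * u x ^ 2)

/-- Square of the norm on `X`: `‖u‖² = [u]² + ∫ V u²`. -/
noncomputable def normSq (N : ℕ) (s : ℝ) (V : Sp N → ℝ) (u : Sp N → ℝ) : ℝ :=
  gagSq N s u + ∫ x, V x * u x ^ 2

/-- The nonlocal term `D_{γ,m}(u) = ∬ |u(x)|^m |u(y)|^m |x-y|^{γ-N}`. -/
noncomputable def Dnl (N : ℕ) (γ m : ℝ) (u : Sp N → ℝ) : ℝ :=
  ∫ z : Sp N × Sp N, |u z.1| ^ m * |u z.2| ^ m * ‖z.1 - z.2‖ ^ (γ - (N : ℝ))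

/-- The energy functional `E_λ`. -/
noncomputable def energy (N : ℕ) (s α β p q lam : ℝ) (V : Sp N → ℝ) (u : Sp N → ℝ) : ℝ :=
  normSq N s V u / 2 - Dnl N α p u / (2 * p) - lam * Dnl N β q u / (2 * q)

/-- The derivative pairing `E'_λ(u)[v]`. -/
noncomputable def pairing (N : ℕ) (s α β p q lam : ℝ) (V : Sp N → ℝ) (u v : Sp N → ℝ) : ℝ :=
  (∫ z : Sp N × Sp N, (u z.1 - u z.2) * (v z.1 - v z.2) * ‖z.1 - z.2‖ ^ (-(N : ℝ) - 2 * s))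
  + (∫ x, V x * u x * v x)
  - (∫ z : Sp N × Sp N, |u z.1| ^ p * |u z.2| ^ (p - 2) * u z.2 * v z.2 * ‖z.1 - z.2‖ ^ (α - (N : ℝ)))
  - lam * (∫ z : Sp N × Sp N, |u z.1| ^ q * |u z.2| ^ (q - 2) * u z.2 * v z.2 * ‖z.1 - z.2‖ ^ (β - (N : ℝ)))

/-- `u` is nonzero as an element of a function space (not a.e. zero). -/
def nonzero (N : ℕ) (u : Sp N → ℝ) : Prop :=
  ¬ (u =ᵐ[(volume : Measure (Sp N))] 0)

/-- The Nehari manifold `N_λ = {u ∈ X \ {0} : ‖u‖² = D_{α,p}(u) + λ D_{β,q}(u)}`. -/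
def NehariD (N : ℕ) (s α β p q lam : ℝ) (V : Sp N → ℝ) : Set (Sp N → ℝ) :=
  {u | memX N s V u ∧ nonzero N u ∧ normSq N s V u = Dnl N α p u + lam * Dnl N β q u}


lemma aux_step (N : ℕ) (hN : 3 ≤ N) (s σ C : ℝ) (hσ : 0 < σ) (hC : 0 < C) :
    ∃ K > (0 : ℝ), ∀ u : Sp N → ℝ, Measurable u →
      ∫⁻ y, ENNReal.ofReal (|u y| ^ σ) ≤ ENNReal.ofReal C → 0 < s → ∀ x,
      ENNReal.ofReal (|u x| ^ (2 + 2 * s * σ / N)) ≤ ENNReal.ofReal K *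
        ∫⁻ y, ENNReal.ofReal ((u x - u y) ^ 2 * ‖x - y‖ ^ (-(N : ℝ) - 2 * s)) := by
  have : Nonempty (Fin N) := ⟨⟨0, by omega⟩⟩
  have hN0 : (0 : ℝ) < N := by exact_mod_cast (by omega : 0 < N)
  set ω : ℝ := (volume (Metric.ball (0 : Sp N) 1)).toReal with hω
  have hωtop : volume (Metric.ball (0 : Sp N) 1) ≠ ⊤ := measure_ball_lt_top.ne
  have hωpos : 0 < ω := ENNReal.toReal_pos (Metric.measure_ball_pos _ _ one_pos).ne' hωtop
  set c : ℝ := 2 * C * 2 ^ σ / ω with hc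
  have hcpos : 0 < c := by positivity
  refine ⟨8 / ω * c ^ (2 * s / N), by positivity, ?_⟩
  intro u hu hint hs x
  by_cases hux : u x = 0
  · rw [hux, abs_zero, Real.zero_rpow (by positivity)]; simp
  set t := |u x| with ht
  have htpos : 0 < t := abs_pos.mpr hux
  set m : ℝ := C / (t / 2) ^ σ with hm
  have hmpos : 0 < m := by positivity
  set w : ℝ := 2 * m / ω with hw
  have hwpos : 0 < w := by positivity
  have hwc : w = c * t ^ (-σ) := by
    rw [hw, hm, hc, Real.div_rpow htpos.le (by norm_num), Real.rpow_neg htpos.le]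
    field_simp
  set r : ℝ := w ^ (1 / (N : ℝ)) with hr
  have hrpos : 0 < r := by positivity
  have hrN : r ^ N = w := by
    rw [hr, ← Real.rpow_natCast, ← Real.rpow_mul hwpos.le]
    simp [hN0.ne']
  set A : Set (Sp N) := {y | ENNReal.ofReal ((t / 2) ^ σ) ≤ ENNReal.ofReal (|u y| ^ σ)} with hA
  have hmeas : Measurable fun y => ENNReal.ofReal (|u y| ^ σ) := by fun_prop
  have hAm : MeasurableSet A := measurableSet_le measurable_const hmeas
  have hAvol : volume A ≤ ENNReal.ofReal m := by
    have h1 := mul_meas_ge_le_lintegral (μ := (volume : Measure (Sp N))) hmeas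
      (ENNReal.ofReal ((t / 2) ^ σ))
    have hp : 0 < (t / 2) ^ σ := by positivity
    rw [hm, ENNReal.ofReal_div_of_pos hp, ENNReal.le_div_iff_mul_le
      (Or.inl (by simpa using hp)) (Or.inl ENNReal.ofReal_ne_top), mul_comm]
    exact h1.trans hint
  have hB : volume (Metric.ball x r) = ENNReal.ofReal (2 * m) := by
    rw [Measure.addHaar_ball volume x hrpos.le, finrank_euclideanSpace, Fintype.card_fin, hrN,
      ← ENNReal.ofReal_toReal hωtop, ← hω, ← ENNReal.ofReal_mul hwpos.le]
    congr 1
    rw [hw]; field_simp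
  have hBA : ENNReal.ofReal m ≤ volume (Metric.ball x r \ A) := by
    refine le_trans ?_ le_measure_sdiff
    rw [hB]
    refine le_trans ?_ (tsub_le_tsub_left hAvol _)
    rw [← ENNReal.ofReal_sub _ hmpos.le]
    apply ENNReal.ofReal_le_ofReal; linarith
  have hlow : ENNReal.ofReal ((t / 2) ^ 2 * r ^ (-(N : ℝ) - 2 * s)) * ENNReal.ofReal m ≤
      ∫⁻ y, ENNReal.ofReal ((u x - u y) ^ 2 * ‖x - y‖ ^ (-(N : ℝ) - 2 * s)) := by
    calc _ ≤ ENNReal.ofReal ((t / 2) ^ 2 * r ^ (-(N : ℝ) - 2 * s)) *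
            volume (Metric.ball x r \ A) := by gcongr
      _ = ∫⁻ _ in Metric.ball x r \ A, ENNReal.ofReal ((t / 2) ^ 2 * r ^ (-(N : ℝ) - 2 * s)) := by
          rw [setLIntegral_const]
      _ ≤ ∫⁻ y in Metric.ball x r \ A,
            ENNReal.ofReal ((u x - u y) ^ 2 * ‖x - y‖ ^ (-(N : ℝ) - 2 * s)) := by
          refine setLIntegral_mono' (Metric.isOpen_ball.measurableSet.diff hAm) ?_
          intro y hy
          have hyA : |u y| < t / 2 := by
            have h2 := hy.2
            simp only [hA, Set.mem_ofPred_eq, not_le] at h2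
            have h3 := (ENNReal.ofReal_lt_ofReal_iff_of_nonneg (by positivity)).1 h2
            exact (Real.rpow_lt_rpow_iff (abs_nonneg _) (by positivity) hσ).1 h3
          have hxy : x ≠ y := by
            rintro rfl
            rw [← ht] at hyA; linarith
          have hn : 0 < ‖x - y‖ := norm_pos_iff.2 (sub_ne_zero.2 hxy)
          have hnr : ‖x - y‖ < r := by
            have := hy.1
            rwa [Metric.mem_ball, dist_comm, dist_eq_norm] at this
          apply ENNReal.ofReal_le_ofReal
          have h4 : t / 2 ≤ |u x - u y| := by
            have := abs_sub_abs_le_abs_sub (u x) (u y)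
            rw [← ht] at this; linarith
          have h5 : (t / 2) ^ 2 ≤ (u x - u y) ^ 2 := by
            rw [← sq_abs (u x - u y)]; gcongr
          have h6 : r ^ (-(N : ℝ) - 2 * s) ≤ ‖x - y‖ ^ (-(N : ℝ) - 2 * s) :=
            Real.rpow_le_rpow_of_nonpos hn hnr.le (by linarith)
          gcongr
      _ ≤ _ := setLIntegral_le_lintegral _ _
  refine le_trans ?_ (mul_le_mul_right hlow _)
  rw [← ENNReal.ofReal_mul (by positivity), ← ENNReal.ofReal_mul (by positivity)]
  apply ENNReal.ofReal_le_ofReal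
  apply le_of_eq
  have e1 : r ^ (-(N : ℝ) - 2 * s) = w⁻¹ * (w ^ (2 * s / N))⁻¹ := by
    rw [hr, ← Real.rpow_mul hwpos.le, ← Real.rpow_neg hwpos.le, ← Real.rpow_neg_one w,
      ← Real.rpow_add hwpos]
    congr 1; field_simp; ring
  have e2 : w ^ (2 * s / N) = c ^ (2 * s / N) * (t ^ (2 * s * σ / N))⁻¹ := by
    rw [hwc, Real.mul_rpow hcpos.le (by positivity), ← Real.rpow_mul htpos.le,
      ← Real.rpow_neg htpos.le]
    congr 2; ring
  have e3 : m = w * ω / 2 := by rw [hw]; field_simp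
  rw [Real.rpow_add htpos, e1, e2, e3, Real.rpow_two]
  have : 0 < c ^ (2 * s / N) := by positivity
  have : 0 < t ^ (2 * s * σ / N) := by positivity
  field_simp
  norm_num

lemma aux_near (N : ℕ) (hN : 3 ≤ N) (b : ℝ) (hb : -(N : ℝ) < b) :
    ∫⁻ z : Sp N, (Metric.ball (0 : Sp N) 1).indicator
      (fun z => ENNReal.ofReal (‖z‖ ^ b)) z < ⊤ := by
  have : Nonempty (Fin N) := ⟨⟨0, by omega⟩⟩
  rw [lintegral_indicator Metric.isOpen_ball.measurableSet]
  have h : IntegrableOn (fun x : Sp N => ‖x‖ ^ b) (Metric.ball (0 : Sp N) 1) volume := by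
    rw [integrableOn_fun_norm_addHaar volume (f := fun y : ℝ => y ^ b)]
    rw [finrank_euclideanSpace, Fintype.card_fin]
    have h1 : IntegrableOn (fun y : ℝ => y ^ ((N : ℝ) - 1 + b)) (Set.Ioo 0 1) :=
      (intervalIntegral.integrableOn_Ioo_rpow_iff one_pos).2 (by linarith)
    refine h1.congr_fun ?_ measurableSet_Ioo
    intro y hy
    simp only [smul_eq_mul]
    rw [Real.rpow_add hy.1, ← Real.rpow_natCast]
    congr 2
    rw [Nat.cast_sub (by omega)]; simp
  exact h.lintegral_lt_top

lemma aux_far (N : ℕ) (b : ℝ) (hb : b < -(N : ℝ)) :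
    ∫⁻ z : Sp N, (Metric.ball (0 : Sp N) 1)ᶜ.indicator
      (fun z => ENNReal.ofReal (‖z‖ ^ b)) z < ⊤ := by
  have h := finite_integral_one_add_norm (E := Sp N) (μ := volume) (r := -b)
    (by rw [finrank_euclideanSpace, Fintype.card_fin]; linarith)
  have h2 : ∫⁻ x : Sp N, ENNReal.ofReal (2 ^ (-b)) * ENNReal.ofReal ((1 + ‖x‖) ^ (- -b)) < ⊤ := by
    rw [lintegral_const_mul _ (by fun_prop)]
    exact ENNReal.mul_lt_top ENNReal.ofReal_lt_top h
  refine lt_of_le_of_lt (lintegral_mono ?_) h2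
  intro z
  by_cases hz : z ∈ (Metric.ball (0 : Sp N) 1)ᶜ
  swap
  · rw [Set.indicator_of_notMem hz]; exact zero_le
  rw [Set.indicator_of_mem hz]
  have hz1 : 1 ≤ ‖z‖ := by simpa using hz
  beta_reduce
  rw [← ENNReal.ofReal_mul (by positivity)]
  apply ENNReal.ofReal_le_ofReal
  have hb0 : b ≤ 0 := by have : (0 : ℝ) ≤ N := Nat.cast_nonneg N
                         linarith
  have h3 : (2 * ‖z‖) ^ b ≤ (1 + ‖z‖) ^ b :=
    Real.rpow_le_rpow_of_nonpos (by positivity) (by linarith) hb0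
  rw [Real.mul_rpow (by norm_num) (by positivity)] at h3
  rw [neg_neg, Real.rpow_neg (by norm_num)]
  have : (0 : ℝ) < 2 ^ b := by positivity
  rw [inv_mul_eq_div, le_div_iff₀ this]
  linarith

lemma aux_sob (N : ℕ) (hN : 3 ≤ N) (s M τ : ℝ) (hs : 0 < s) (hs1 : s < 1) (hτ2 : 2 ≤ τ)
    (hτ : τ * ((N : ℝ) - 2 * s) < 2 * N) :
    ∃ C > (0 : ℝ), ∀ u : Sp N → ℝ, Measurable u →
      ∫⁻ y, ENNReal.ofReal (u y ^ 2) ≤ ENNReal.ofReal M →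
      ∫⁻ x, ∫⁻ y, ENNReal.ofReal ((u x - u y) ^ 2 * ‖x - y‖ ^ (-(N : ℝ) - 2 * s)) ≤ 1 →
      ∫⁻ y, ENNReal.ofReal (|u y| ^ τ) ≤ ENNReal.ofReal C := by
  have hN3 : (3 : ℝ) ≤ N := by exact_mod_cast hN
  have hN0 : (0 : ℝ) < N := by linarith
  obtain ⟨δ, hδ⟩ : ∃ δ, δ = 2 - τ * (1 - 2 * s / N) := ⟨_, rfl⟩
  have h1s : 0 ≤ 1 - 2 * s / N := by
    rw [sub_nonneg, div_le_one hN0]; linarith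
  have hδpos : 0 < δ := by
    have : τ * (1 - 2 * s / N) = τ * ((N : ℝ) - 2 * s) / N := by field_simp
    rw [hδ, this, sub_pos, div_lt_iff₀ hN0]; exact hτ
  have key : ∀ n : ℕ, ∃ C > (0 : ℝ), ∀ u : Sp N → ℝ, Measurable u →
      ∫⁻ y, ENNReal.ofReal (u y ^ 2) ≤ ENNReal.ofReal M →
      ∫⁻ x, ∫⁻ y, ENNReal.ofReal ((u x - u y) ^ 2 * ‖x - y‖ ^ (-(N : ℝ) - 2 * s)) ≤ 1 →
      ∫⁻ y, ENNReal.ofReal (|u y| ^ (min τ (2 + n * δ))) ≤ ENNReal.ofReal C := by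
    intro n
    induction n with
    | zero =>
      refine ⟨max M 1, by positivity, ?_⟩
      intro u hu h2 _
      have : min τ (2 + ((0 : ℕ) : ℝ) * δ) = 2 := by simp [hτ2]
      rw [this]
      simp only [Real.rpow_two, sq_abs]
      exact h2.trans (ENNReal.ofReal_le_ofReal (le_max_left _ _))
    | succ n ih =>
      obtain ⟨C, hC, ih⟩ := ih
      obtain ⟨σ, hσ⟩ : ∃ σ, σ = min τ (2 + n * δ) := ⟨_, rfl⟩
      have hσ2 : 2 ≤ σ := by
        rw [hσ]; exact le_min hτ2 (by have : (0:ℝ) ≤ n * δ := by positivity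
                                      linarith)
      have hστ : σ ≤ τ := by rw [hσ]; exact min_le_left _ _
      rw [← hσ] at ih
      obtain ⟨K, hK, hstep⟩ := aux_step N hN s σ C (by linarith) hC
      refine ⟨max M 1 + K, by positivity, ?_⟩
      intro u hu h2 hg
      have h3 := hstep u hu (ih u hu h2 hg) hs
      obtain ⟨σ', hσ'⟩ : ∃ σ', σ' = min τ (2 + ((n + 1 : ℕ) : ℝ) * δ) := ⟨_, rfl⟩
      rw [← hσ']
      have hσ'2 : 2 ≤ σ' := by
        rw [hσ']; exact le_min hτ2 (by have : (0:ℝ) ≤ ((n + 1 : ℕ) : ℝ) * δ := by positivity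
                                       linarith)
      have hup : σ + δ ≤ 2 + 2 * s * σ / N := by
        have h4 : σ * (1 - 2 * s / N) ≤ τ * (1 - 2 * s / N) := by gcongr
        have h5 : 2 * s * σ / N = σ * (2 * s / N) := by ring
        rw [h5]; linarith
      have hle : σ' ≤ 2 + 2 * s * σ / N := by
        refine le_trans ?_ hup
        rw [hσ, hσ', min_add]
        apply le_min
        · exact (min_le_left _ _).trans (by linarith)
        · exact (min_le_right _ _).trans (by push_cast; linarith)
      calc ∫⁻ y, ENNReal.ofReal (|u y| ^ σ')
          ≤ ∫⁻ y, (ENNReal.ofReal (u y ^ 2) + ENNReal.ofReal K * ∫⁻ z,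
            ENNReal.ofReal ((u y - u z) ^ 2 * ‖y - z‖ ^ (-(N : ℝ) - 2 * s))) := by
            refine lintegral_mono fun y => ?_
            refine le_trans ?_ (add_le_add_right (h3 y) _)
            rw [← ENNReal.ofReal_add (by positivity) (by positivity)]
            apply ENNReal.ofReal_le_ofReal
            have e2 : u y ^ 2 = |u y| ^ (2 : ℝ) := by rw [Real.rpow_two, sq_abs]
            rcases le_total (|u y|) 1 with h | h
            · have : |u y| ^ σ' ≤ |u y| ^ (2 : ℝ) := by
                rcases (abs_nonneg (u y)).eq_or_lt with h0 | h0
                · rw [← h0, Real.zero_rpow (by linarith), Real.zero_rpow (by norm_num)]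
                · exact Real.rpow_le_rpow_of_exponent_ge h0 h hσ'2
              rw [e2]
              have : 0 ≤ |u y| ^ (2 + 2 * s * σ / N) := by positivity
              linarith
            · have := Real.rpow_le_rpow_of_exponent_le h hle
              have : 0 ≤ u y ^ 2 := by positivity
              linarith
        _ = (∫⁻ y, ENNReal.ofReal (u y ^ 2)) + ENNReal.ofReal K * ∫⁻ y, ∫⁻ z,
            ENNReal.ofReal ((u y - u z) ^ 2 * ‖y - z‖ ^ (-(N : ℝ) - 2 * s)) := by
            rw [lintegral_add_left (by fun_prop), lintegral_const_mul' _ _ ENNReal.ofReal_ne_top]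
        _ ≤ ENNReal.ofReal (max M 1) + ENNReal.ofReal K * 1 := by
            gcongr
            exact h2.trans (ENNReal.ofReal_le_ofReal (le_max_left _ _))
        _ = _ := by rw [mul_one, ENNReal.ofReal_add (by positivity) hK.le]
  obtain ⟨n, hn⟩ := exists_nat_ge ((τ - 2) / δ)
  have : min τ (2 + n * δ) = τ := by
    rw [div_le_iff₀ hδpos] at hn
    exact min_eq_left (by linarith)
  have h := key n
  rwa [this] at h

lemma aux_young (r f g k : ℝ) (hr1 : 1 < r) (hr2 : r < 2) (hf : 0 ≤ f) (hg : 0 ≤ g) (hk : 0 ≤ k) :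
    f * g * k ≤ f ^ r * g ^ r + f ^ r * k ^ (1 / (2 - 2 / r)) + g ^ r * k ^ (1 / (2 - 2 / r)) := by
  have hr0 : 0 < r := by linarith
  have hw0 : 0 ≤ 2 / r - 1 := by rw [sub_nonneg, le_div_iff₀ hr0]; linarith
  have hw : 0 ≤ 1 - 1 / r := by rw [sub_nonneg, div_le_iff₀ hr0]; linarith
  have hd : 0 < 2 - 2 / r := by rw [sub_pos, div_lt_iff₀ hr0]; linarith
  obtain ⟨a, ha⟩ : ∃ a, a = 1 / (2 - 2 / r) := ⟨_, rfl⟩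
  rw [← ha]
  have hapos : 0 < a := by rw [ha]; positivity
  rcases hf.eq_or_lt with h | hf'
  · rw [← h, zero_mul, zero_mul]; positivity
  rcases hg.eq_or_lt with h | hg'
  · rw [← h, mul_zero, zero_mul]; positivity
  rcases hk.eq_or_lt with h | hk'
  · rw [← h, mul_zero]; positivity
  have h := Real.geom_mean_le_arith_mean3_weighted hw0 hw hw
    (by positivity : 0 ≤ f ^ r * g ^ r) (by positivity : 0 ≤ f ^ r * k ^ a)
    (by positivity : 0 ≤ g ^ r * k ^ a) (by ring)
  have e : (f ^ r * g ^ r) ^ (2 / r - 1) * (f ^ r * k ^ a) ^ (1 - 1 / r) *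
      (g ^ r * k ^ a) ^ (1 - 1 / r) = f * g * k := by
    rw [Real.mul_rpow (by positivity) (by positivity), Real.mul_rpow (by positivity) (by positivity),
      Real.mul_rpow (by positivity) (by positivity)]
    simp only [← Real.rpow_mul hf, ← Real.rpow_mul hg, ← Real.rpow_mul hk]
    have ef : f ^ (r * (2 / r - 1)) * f ^ (r * (1 - 1 / r)) = f := by
      rw [← Real.rpow_add hf']
      have : r * (2 / r - 1) + r * (1 - 1 / r) = 1 := by field_simp; ring
      rw [this, Real.rpow_one]
    have eg : g ^ (r * (2 / r - 1)) * g ^ (r * (1 - 1 / r)) = g := by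
      rw [← Real.rpow_add hg']
      have : r * (2 / r - 1) + r * (1 - 1 / r) = 1 := by field_simp; ring
      rw [this, Real.rpow_one]
    have ek : k ^ (a * (1 - 1 / r)) * k ^ (a * (1 - 1 / r)) = k := by
      rw [← Real.rpow_add hk']
      have : a * (1 - 1 / r) + a * (1 - 1 / r) = a * (2 - 2 / r) := by ring
      rw [this, ha, one_div_mul_cancel hd.ne', Real.rpow_one]
    calc _ = (f ^ (r * (2 / r - 1)) * f ^ (r * (1 - 1 / r))) *
          (g ^ (r * (2 / r - 1)) * g ^ (r * (1 - 1 / r))) *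
          (k ^ (a * (1 - 1 / r)) * k ^ (a * (1 - 1 / r))) := by ring
      _ = _ := by rw [ef, eg, ek]
  rw [e] at h
  have b0 : 2 / r - 1 ≤ 1 := by
    have : 2 / r ≤ 2 := by linarith
    linarith
  have b1 : 1 - 1 / r ≤ 1 := by
    have : 0 < 1 / r := by positivity
    linarith
  have c1 := mul_le_of_le_one_left (by positivity : 0 ≤ f ^ r * g ^ r) b0
  have c2 := mul_le_of_le_one_left (by positivity : 0 ≤ f ^ r * k ^ a) b1
  have c3 := mul_le_of_le_one_left (by positivity : 0 ≤ g ^ r * k ^ a) b1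
  linarith

lemma aux_young_int (N : ℕ) (γ m r C : ℝ) (S : Set (Sp N)) (hS : MeasurableSet S)
    (hr1 : 1 < r) (hr2 : r < 2) (u : Sp N → ℝ) (hu : Measurable u)
    (hI : ∫⁻ y, ENNReal.ofReal (|u y| ^ (m * r)) ≤ ENNReal.ofReal C) :
    ∫⁻ z : Sp N × Sp N, S.indicator (fun w => ENNReal.ofReal (‖w‖ ^ (γ - (N : ℝ)))) (z.1 - z.2) *
      ENNReal.ofReal (|u z.1| ^ m * |u z.2| ^ m) ≤
    ENNReal.ofReal C * ENNReal.ofReal C + ENNReal.ofReal C *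
      (∫⁻ w, S.indicator (fun w => ENNReal.ofReal (‖w‖ ^ ((γ - (N : ℝ)) * (1 / (2 - 2 / r))))) w)
      + ENNReal.ofReal C *
      (∫⁻ w, S.indicator
        (fun w => ENNReal.ofReal (‖w‖ ^ ((γ - (N : ℝ)) * (1 / (2 - 2 / r))))) w) := by
  obtain ⟨a, ha⟩ : ∃ a, a = 1 / (2 - 2 / r) := ⟨_, rfl⟩
  rw [← ha]
  obtain ⟨F, hF⟩ : ∃ F : Sp N → ENNReal, F = fun y => ENNReal.ofReal (|u y| ^ (m * r)) := ⟨_, rfl⟩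
  obtain ⟨H, hH⟩ : ∃ H : Sp N → ENNReal,
    H = S.indicator (fun w => ENNReal.ofReal (‖w‖ ^ ((γ - (N : ℝ)) * a))) := ⟨_, rfl⟩
  have hFm : Measurable F := by rw [hF]; fun_prop
  have hHm : Measurable H := by rw [hH]; exact Measurable.indicator (by fun_prop) hS
  have hpt : ∀ z : Sp N × Sp N,
      S.indicator (fun w => ENNReal.ofReal (‖w‖ ^ (γ - (N : ℝ)))) (z.1 - z.2) *
      ENNReal.ofReal (|u z.1| ^ m * |u z.2| ^ m) ≤
      F z.1 * F z.2 + F z.1 * H (z.1 - z.2) + F z.2 * H (z.1 - z.2) := by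
    intro z
    by_cases hz : z.1 - z.2 ∈ S
    swap
    · rw [Set.indicator_of_notMem hz, zero_mul]; exact zero_le
    rw [hH, hF, Set.indicator_of_mem hz, Set.indicator_of_mem hz]
    simp only
    rw [← ENNReal.ofReal_mul (by positivity), ← ENNReal.ofReal_mul (by positivity),
      ← ENNReal.ofReal_mul (by positivity), ← ENNReal.ofReal_mul (by positivity),
      ← ENNReal.ofReal_add (by positivity) (by positivity),
      ← ENNReal.ofReal_add (by positivity) (by positivity)]
    apply ENNReal.ofReal_le_ofReal
    have := aux_young r (|u z.1| ^ m) (|u z.2| ^ m) (‖z.1 - z.2‖ ^ (γ - (N : ℝ))) hr1 hr2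
      (by positivity) (by positivity) (by positivity)
    rw [← ha, ← Real.rpow_mul (abs_nonneg _), ← Real.rpow_mul (abs_nonneg _),
      ← Real.rpow_mul (norm_nonneg _)] at this
    rw [mul_comm]
    exact this
  have hI' : ∫⁻ y, F y ≤ ENNReal.ofReal C := by rw [hF]; exact hI
  rw [← hH]
  have m1 : Measurable fun z : Sp N × Sp N => F z.1 * F z.2 := by fun_prop
  have m2 : Measurable fun z : Sp N × Sp N => F z.1 * H (z.1 - z.2) := by fun_prop
  have m3 : Measurable fun z : Sp N × Sp N => F z.2 * H (z.1 - z.2) := by fun_prop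
  refine (lintegral_mono hpt).trans ?_
  rw [lintegral_add_right _ m3, lintegral_add_right _ m2]
  gcongr
  · rw [Measure.volume_eq_prod, lintegral_prod_mul hFm.aemeasurable hFm.aemeasurable]
    gcongr
  · rw [Measure.volume_eq_prod, lintegral_prod _ m2.aemeasurable]
    have : ∀ x, ∫⁻ y, F x * H (x - y) = F x * ∫⁻ w, H w := by
      intro x
      rw [lintegral_const_mul _ (by fun_prop), lintegral_sub_left_eq_self]
    simp only [this]
    rw [lintegral_mul_const _ hFm]
    gcongr
  · rw [Measure.volume_eq_prod, lintegral_prod_symm _ m3.aemeasurable]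
    have : ∀ y, ∫⁻ x, F y * H (x - y) = F y * ∫⁻ w, H w := by
      intro x
      rw [lintegral_const_mul _ (by fun_prop), lintegral_sub_right_eq_self]
    simp only [this]
    rw [lintegral_mul_const _ hFm]
    gcongr

lemma aux_D (N : ℕ) (hN : 3 ≤ N) (s M γ m : ℝ) (hs : 0 < s) (hs1 : s < 1)
    (hγ0 : 0 < γ) (hγN : γ < N)
    (hl : ((N : ℝ) + γ) / N < m) (hu : m < ((N : ℝ) + γ) / ((N : ℝ) - 2 * s)) :
    ∃ C > (0 : ℝ), ∀ u : Sp N → ℝ, Measurable u →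
      ∫⁻ y, ENNReal.ofReal (u y ^ 2) ≤ ENNReal.ofReal M →
      ∫⁻ x, ∫⁻ y, ENNReal.ofReal ((u x - u y) ^ 2 * ‖x - y‖ ^ (-(N : ℝ) - 2 * s)) ≤ 1 →
      Dnl N γ m u ≤ C := by
  have hN3 : (3 : ℝ) ≤ N := by exact_mod_cast hN
  have hN0 : (0 : ℝ) < N := by linarith
  have hNs : 0 < (N : ℝ) - 2 * s := by linarith
  rw [div_lt_iff₀ hN0] at hl
  rw [lt_div_iff₀ hNs] at hu
  have hm0 : 0 < m := by
    by_contra h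
    push Not at h
    have := mul_nonpos_of_nonpos_of_nonneg h hN0.le
    linarith
  have hg : 0 < (N : ℝ) + γ := by linarith
  have hmNs : 0 < m * ((N : ℝ) - 2 * s) := by positivity
  -- exponent for the near part
  obtain ⟨r₁, h1a, h1b⟩ : ∃ r, 2 * N / (N + γ) < r ∧ r < min 2 (2 * N / (m * (N - 2 * s))) := by
    apply exists_between
    apply lt_min
    · rw [div_lt_iff₀ hg]; linarith
    · exact div_lt_div_of_pos_left (by positivity) hmNs hu
  have h1c := lt_of_lt_of_le h1b (min_le_left _ _)
  have h1d := lt_of_lt_of_le h1b (min_le_right _ _)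
  rw [lt_div_iff₀ hmNs] at h1d
  rw [div_lt_iff₀ hg] at h1a
  -- exponent for the far part
  obtain ⟨r₂, h2a, h2b⟩ : ∃ r, max 1 (2 / m) < r ∧ r < 2 * N / (N + γ) := by
    apply exists_between
    apply max_lt
    · rw [lt_div_iff₀ hg]; linarith
    · rw [div_lt_div_iff₀ hm0 hg]; linarith
  have h2c := lt_of_le_of_lt (le_max_left _ _) h2a
  have h2d := lt_of_le_of_lt (le_max_right _ _) h2a
  rw [div_lt_iff₀ hm0] at h2d
  rw [lt_div_iff₀ hg] at h2b
  have h1e : 1 < r₁ := by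
    by_contra h
    push Not at h
    have := mul_le_mul_of_nonneg_right h hg.le
    linarith
  have h2e : r₂ < 2 := by
    by_contra h
    push Not at h
    have := mul_le_mul_of_nonneg_right h hg.le
    linarith
  have hd1 : 0 < 2 - 2 / r₁ := by rw [sub_pos, div_lt_iff₀ (by linarith)]; linarith
  have hd2 : 0 < 2 - 2 / r₂ := by rw [sub_pos, div_lt_iff₀ (by linarith)]; linarith
  have hb1 : -(N : ℝ) < (γ - N) * (1 / (2 - 2 / r₁)) := by
    rw [mul_one_div, lt_div_iff₀ hd1]
    have : N * (2 / r₁) < N + γ := by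
      rw [← mul_div_assoc, div_lt_iff₀ (by linarith)]; linarith
    nlinarith
  have hb2 : (γ - N) * (1 / (2 - 2 / r₂)) < -(N : ℝ) := by
    rw [mul_one_div, div_lt_iff₀ hd2]
    have : N + γ < N * (2 / r₂) := by
      rw [← mul_div_assoc, lt_div_iff₀ (by linarith)]; linarith
    nlinarith
  have hn := aux_near N hN _ hb1
  have hf := aux_far N _ hb2
  obtain ⟨C₁, hC₁, hS₁⟩ := aux_sob N hN s M (m * r₁) hs hs1
    (by
      have : (N + γ) * r₁ < m * N * r₁ := mul_lt_mul_of_pos_right hl (by linarith)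
      by_contra h
      push Not at h
      have := mul_lt_mul_of_pos_right h hN0
      nlinarith) (by linarith)
  obtain ⟨C₂, hC₂, hS₂⟩ := aux_sob N hN s M (m * r₂) hs hs1 (by linarith)
    (by
      have : m * (N - 2 * s) * r₂ < (N + γ) * r₂ := mul_lt_mul_of_pos_right hu (by linarith)
      linarith)
  obtain ⟨J₁, hJ₁⟩ : ∃ J, J = ∫⁻ w : Sp N, (Metric.ball (0 : Sp N) 1).indicator
      (fun w => ENNReal.ofReal (‖w‖ ^ ((γ - (N : ℝ)) * (1 / (2 - 2 / r₁))))) w := ⟨_, rfl⟩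
  obtain ⟨J₂, hJ₂⟩ : ∃ J, J = ∫⁻ w : Sp N, (Metric.ball (0 : Sp N) 1)ᶜ.indicator
      (fun w => ENNReal.ofReal (‖w‖ ^ ((γ - (N : ℝ)) * (1 / (2 - 2 / r₂))))) w := ⟨_, rfl⟩
  rw [← hJ₁] at hn
  rw [← hJ₂] at hf
  obtain ⟨T, hT⟩ : ∃ T, T = (ENNReal.ofReal C₁ * ENNReal.ofReal C₁ + ENNReal.ofReal C₁ * J₁ +
    ENNReal.ofReal C₁ * J₁) + (ENNReal.ofReal C₂ * ENNReal.ofReal C₂ + ENNReal.ofReal C₂ * J₂ +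
    ENNReal.ofReal C₂ * J₂) := ⟨_, rfl⟩
  have hTtop : T ≠ ⊤ := by
    rw [hT]
    have a1 := ENNReal.mul_lt_top (ENNReal.ofReal_lt_top (r := C₁)) (ENNReal.ofReal_lt_top (r := C₁))
    have a2 := ENNReal.mul_lt_top (ENNReal.ofReal_lt_top (r := C₁)) hn
    have a3 := ENNReal.mul_lt_top (ENNReal.ofReal_lt_top (r := C₂)) (ENNReal.ofReal_lt_top (r := C₂))
    have a4 := ENNReal.mul_lt_top (ENNReal.ofReal_lt_top (r := C₂)) hf
    exact (ENNReal.add_lt_top.2 ⟨ENNReal.add_lt_top.2 ⟨ENNReal.add_lt_top.2 ⟨a1, a2⟩, a2⟩,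
      ENNReal.add_lt_top.2 ⟨ENNReal.add_lt_top.2 ⟨a3, a4⟩, a4⟩⟩).ne
  refine ⟨T.toReal + 1, by positivity, ?_⟩
  intro u hum h2 hgag
  have y1 := aux_young_int N γ m r₁ C₁ (Metric.ball (0 : Sp N) 1) Metric.isOpen_ball.measurableSet
    h1e h1c u hum (hS₁ u hum h2 hgag)
  have y2 := aux_young_int N γ m r₂ C₂ (Metric.ball (0 : Sp N) 1)ᶜ
    Metric.isOpen_ball.measurableSet.compl h2c h2e u hum (hS₂ u hum h2 hgag)
  rw [← hJ₁] at y1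
  rw [← hJ₂] at y2
  have htot : ∫⁻ z : Sp N × Sp N,
      ENNReal.ofReal (|u z.1| ^ m * |u z.2| ^ m * ‖z.1 - z.2‖ ^ (γ - (N : ℝ))) ≤ T := by
    rw [hT]
    refine le_trans ?_ (add_le_add y1 y2)
    rw [← lintegral_add_left]
    · refine lintegral_mono fun z => ?_
      beta_reduce
      rw [← add_mul, Set.indicator_self_add_compl_apply, ← ENNReal.ofReal_mul (by positivity)]
      rw [mul_comm]
    · have : Measurable ((Metric.ball (0 : Sp N) 1).indicator
          (fun w => ENNReal.ofReal (‖w‖ ^ (γ - (N : ℝ))))) :=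
        Measurable.indicator (by fun_prop) Metric.isOpen_ball.measurableSet
      fun_prop
  rw [Dnl, integral_eq_lintegral_of_nonneg_ae]
  · have := ENNReal.toReal_mono hTtop htot
    linarith
  · exact Eventually.of_forall fun z => by simp only [Pi.zero_apply]; positivity
  · exact Measurable.aestronglyMeasurable (by fun_prop)

lemma aux_X (N : ℕ) (hN : 3 ≤ N) (s γ m V₀ : ℝ) (V : Sp N → ℝ) (hs : 0 < s) (hs1 : s < 1)
    (hγ0 : 0 < γ) (hγN : γ < N) (hV₀ : 0 < V₀) (hV : ∀ x, V₀ ≤ V x)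
    (hl : ((N : ℝ) + γ) / N < m) (hu : m < ((N : ℝ) + γ) / ((N : ℝ) - 2 * s)) :
    ∃ C > (0 : ℝ), ∀ u : Sp N → ℝ, memX N s V u → normSq N s V u ≤ 1 → Dnl N γ m u ≤ C := by
  obtain ⟨C, hC, h⟩ := aux_D N hN s V₀⁻¹ γ m hs hs1 hγ0 hγN hl hu
  refine ⟨C, hC, ?_⟩
  intro u hX hn
  obtain ⟨hum, hg, hv⟩ := hX
  have hVn : ∀ x, 0 ≤ V x * u x ^ 2 := fun x =>
    mul_nonneg (hV₀.le.trans (hV x)) (sq_nonneg _)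
  have i1 : 0 ≤ gagSq N s u := integral_nonneg fun z => by simp only [Pi.zero_apply]; positivity
  have i2 : 0 ≤ ∫ x, V x * u x ^ 2 := integral_nonneg hVn
  rw [normSq] at hn
  apply h u hum
  · calc ∫⁻ y, ENNReal.ofReal (u y ^ 2) ≤ ∫⁻ y, ENNReal.ofReal (V₀⁻¹ * (V y * u y ^ 2)) := by
          refine lintegral_mono fun y => ENNReal.ofReal_le_ofReal ?_
          rw [← mul_assoc]
          apply le_mul_of_one_le_left (sq_nonneg _)
          rw [inv_mul_eq_div, one_le_div hV₀]
          exact hV y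
      _ = ENNReal.ofReal (∫ y, V₀⁻¹ * (V y * u y ^ 2)) := by
          rw [ofReal_integral_eq_lintegral_ofReal (hv.const_mul _)]
          exact Eventually.of_forall fun y => mul_nonneg (by positivity) (hVn y)
      _ ≤ _ := by
          apply ENNReal.ofReal_le_ofReal
          rw [integral_const_mul]
          exact mul_le_of_le_one_right (by positivity) (by linarith)
  · have e : ∫⁻ z : Sp N × Sp N, ENNReal.ofReal
        ((u z.1 - u z.2) ^ 2 * ‖z.1 - z.2‖ ^ (-(N : ℝ) - 2 * s)) = ENNReal.ofReal (gagSq N s u) := by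
      rw [gagSq, ofReal_integral_eq_lintegral_ofReal hg]
      exact Eventually.of_forall fun z => by simp only [Pi.zero_apply]; positivity
    rw [Measure.volume_eq_prod, lintegral_prod _ (by fun_prop)] at e
    rw [e, ← ENNReal.ofReal_one]
    exact ENNReal.ofReal_le_ofReal (by linarith)

lemma aux_hom (N : ℕ) (hN : 3 ≤ N) (s γ m V₀ : ℝ) (V : Sp N → ℝ) (hs : 0 < s) (hs1 : s < 1)
    (hγ0 : 0 < γ) (hγN : γ < N) (hV₀ : 0 < V₀) (hV : ∀ x, V₀ ≤ V x)
    (hl : ((N : ℝ) + γ) / N < m) (hu : m < ((N : ℝ) + γ) / ((N : ℝ) - 2 * s)) :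
    ∃ C > (0 : ℝ), ∀ u : Sp N → ℝ, memX N s V u → 0 < normSq N s V u →
      Dnl N γ m u ≤ C * normSq N s V u ^ m := by
  obtain ⟨C, hC, h⟩ := aux_X N hN s γ m V₀ V hs hs1 hγ0 hγN hV₀ hV hl hu
  refine ⟨C, hC, ?_⟩
  intro u hX hpos
  obtain ⟨t, ht⟩ : ∃ t, t = normSq N s V u := ⟨_, rfl⟩
  rw [← ht] at hpos ⊢
  obtain ⟨c, hc⟩ : ∃ c, c = (Real.sqrt t)⁻¹ := ⟨_, rfl⟩
  have hcpos : 0 < c := by rw [hc]; positivity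
  have hc2 : c ^ 2 = t⁻¹ := by rw [hc, inv_pow, Real.sq_sqrt hpos.le]
  have e1 : ∀ z : Sp N × Sp N, (c * u z.1 - c * u z.2) ^ 2 * ‖z.1 - z.2‖ ^ (-(N : ℝ) - 2 * s) =
      c ^ 2 * ((u z.1 - u z.2) ^ 2 * ‖z.1 - z.2‖ ^ (-(N : ℝ) - 2 * s)) := fun z => by ring
  have e2 : ∀ x, V x * (c * u x) ^ 2 = c ^ 2 * (V x * u x ^ 2) := fun x => by ring
  have e3 : ∀ z : Sp N × Sp N, |c * u z.1| ^ m * |c * u z.2| ^ m * ‖z.1 - z.2‖ ^ (γ - (N : ℝ)) =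
      (t ^ m)⁻¹ * (|u z.1| ^ m * |u z.2| ^ m * ‖z.1 - z.2‖ ^ (γ - (N : ℝ))) := fun z => by
    have : c ^ m * c ^ m = (t ^ m)⁻¹ := by
      rw [← Real.mul_rpow hcpos.le hcpos.le, ← sq, hc2, Real.inv_rpow hpos.le]
    rw [abs_mul, abs_mul, abs_of_pos hcpos, Real.mul_rpow hcpos.le (abs_nonneg _),
      Real.mul_rpow hcpos.le (abs_nonneg _), ← this]
    ring
  have hX' : memX N s V (fun x => c * u x) := by
    obtain ⟨hum, hg, hv⟩ := hX
    refine ⟨hum.const_mul c, ?_, ?_⟩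
    · simp only [e1]; exact hg.const_mul _
    · simp only [e2]; exact hv.const_mul _
  have hn' : normSq N s V (fun x => c * u x) = 1 := by
    rw [normSq, gagSq]
    simp only [e1, e2]
    rw [integral_const_mul, integral_const_mul, ← mul_add, hc2]
    change t⁻¹ * normSq N s V u = 1
    rw [← ht]
    exact inv_mul_cancel₀ hpos.ne'
  have hD := h _ hX' hn'.le
  have hD' : Dnl N γ m (fun x => c * u x) = (t ^ m)⁻¹ * Dnl N γ m u := by
    rw [Dnl, Dnl]
    simp only [e3]
    rw [integral_const_mul]
  rw [hD', inv_mul_le_iff₀ (by positivity)] at hD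
  linarith

/-- The norm is bounded below by a positive constant on the Nehari manifold. -/
theorem nehari_norm_lower_bound
    (N : ℕ) (s α β p q lam : ℝ) (V : Sp N → ℝ)
    (hN : 3 ≤ N) (hs : s ∈ Set.Ioo (0 : ℝ) 1)
    (hα : α ∈ Set.Ioo (0 : ℝ) (N : ℝ)) (hβ : β ∈ Set.Ioo (0 : ℝ) (N : ℝ))
    (hV : Continuous V) (hV1 : ∃ V₀ > 0, ∀ x, V₀ ≤ V x)
    (hq1 : 1 < q) (hpq : q < p) (hlam : 0 < lam)
    (hpl : ((N : ℝ) + α) / N < p) (hpu : p < ((N : ℝ) + α) / ((N : ℝ) - 2 * s))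
    (hql : ((N : ℝ) + β) / N < q) (hqu : q < ((N : ℝ) + β) / ((N : ℝ) - 2 * s)) :
    ∃ C₀ > (0 : ℝ), ∀ u ∈ NehariD N s α β p q lam V,
      C₀ ≤ Real.sqrt (normSq N s V u) := by
  obtain ⟨V₀, hV₀, hV1⟩ := hV1
  obtain ⟨C₁, hC₁, h₁⟩ := aux_hom N hN s α p V₀ V hs.1 hs.2 hα.1 hα.2 hV₀ hV1 hpl hpu
  obtain ⟨C₂, hC₂, h₂⟩ := aux_hom N hN s β q V₀ V hs.1 hs.2 hβ.1 hβ.2 hV₀ hV1 hql hqu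
  obtain ⟨A, hA⟩ : ∃ A, A = C₁ + lam * C₂ := ⟨_, rfl⟩
  have hApos : 0 < A := by rw [hA]; positivity
  refine ⟨Real.sqrt (min 1 (A⁻¹ ^ (1 / (q - 1)))), by positivity, ?_⟩
  intro u hu
  obtain ⟨hX, hnz, heq⟩ := hu
  apply Real.sqrt_le_sqrt
  have hVn : ∀ x, 0 ≤ V x * u x ^ 2 := fun x =>
    mul_nonneg (hV₀.le.trans (hV1 x)) (sq_nonneg _)
  have hpos : 0 < normSq N s V u := by
    have i1 : 0 ≤ gagSq N s u := integral_nonneg fun z => by simp only [Pi.zero_apply]; positivity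
    have i2 : 0 < ∫ x, V x * u x ^ 2 := by
      refine lt_of_le_of_ne (integral_nonneg hVn) fun h0 => hnz ?_
      have h3 := (integral_eq_zero_iff_of_nonneg hVn hX.2.2).1 h0.symm
      filter_upwards [h3] with x hx
      have hx' : V x * u x ^ 2 = 0 := hx
      have hVx : V x ≠ 0 := (lt_of_lt_of_le hV₀ (hV1 x)).ne'
      simpa [hVx] using hx'
    rw [normSq]; linarith
  have b1 := h₁ u hX hpos
  have b2 := h₂ u hX hpos
  obtain ⟨t, ht⟩ : ∃ t, t = normSq N s V u := ⟨_, rfl⟩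
  rw [← ht] at hpos heq b1 b2 ⊢
  rcases le_total 1 t with h | h
  · exact (min_le_left _ _).trans h
  refine (min_le_right _ _).trans ?_
  have hpq' : t ^ p ≤ t ^ q := Real.rpow_le_rpow_of_exponent_ge hpos h hpq.le
  have h3 : t ≤ A * t ^ q := by
    have c1 := mul_le_mul_of_nonneg_left hpq' hC₁.le
    have c2 := mul_le_mul_of_nonneg_left b2 hlam.le
    rw [hA]; linarith
  have h4 : A⁻¹ ≤ t ^ (q - 1) := by
    rw [Real.rpow_sub_one hpos.ne', le_div_iff₀ hpos, inv_mul_le_iff₀ hApos]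
    exact h3
  calc A⁻¹ ^ (1 / (q - 1)) ≤ (t ^ (q - 1)) ^ (1 / (q - 1)) := by
        have : 0 ≤ 1 / (q - 1) := by rw [one_div, inv_nonneg]; linarith
        gcongr
    _ = t := by
        rw [← Real.rpow_mul hpos.le, mul_one_div_cancel (by linarith), Real.rpow_one]
end
end

section
/- Assume p > q > 1, λ > 0, that p and q satisfy (N+α)/N < p < (N+α)/(N−2s) and (N+β)/N < q < (N+β)/(N−2s), and that V satisfies (V1). Then the restriction of the energy E_λ to the Nehari manifold N_λ is bounded from below by a positive constant: there exists c > 0 such that E_λ(u) ≥ c for all u ∈ N_λ; in fact E_λ(u) ≥ (1/2 − 1/(2q)) ‖u‖² for every u ∈ N_λ. -/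
open MeasureTheory Real Filter Topology

noncomputable section

lemma hlp_ptwise (N : ℕ) (hN : 0 < N) (s σ A : ℝ) (hs : 0 < s) (hσ : 0 < σ) (hA : 0 < A) :
    ∃ C : ℝ, 0 < C ∧ ∀ u : Sp N → ℝ, Measurable u →
      ∫⁻ x, ENNReal.ofReal (|u x| ^ σ) ≤ ENNReal.ofReal A →
      ∀ x, ENNReal.ofReal (|u x| ^ (2 + 2 * s * σ / N)) ≤
        ENNReal.ofReal C * ∫⁻ y, ENNReal.ofReal ((u x - u y) ^ 2 * ‖x - y‖ ^ (-(N : ℝ) - 2 * s)) := by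
  haveI : Nonempty (Fin N) := ⟨⟨0, hN⟩⟩
  have hNr : (0 : ℝ) < N := by exact_mod_cast hN
  set ω : ℝ := (volume (Metric.ball (0 : Sp N) 1)).toReal with hω
  have hωtop : volume (Metric.ball (0 : Sp N) 1) ≠ ⊤ := measure_ball_lt_top.ne
  have hωpos : 0 < ω := ENNReal.toReal_pos (Metric.measure_ball_pos _ _ one_pos).ne' hωtop
  have hωe : volume (Metric.ball (0 : Sp N) 1) = ENNReal.ofReal ω := (ENNReal.ofReal_toReal hωtop).symm
  set L : ℝ := 2 * A * 2 ^ σ / ω with hL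
  have hLpos : 0 < L := by positivity
  refine ⟨8 / ω * L ^ (2 * s / N), by positivity, ?_⟩
  intro u hu hI x
  rcases eq_or_ne (u x) 0 with h0 | h0
  · rw [h0, abs_zero, Real.zero_rpow (by positivity)]; simp
  set t := |u x| with ht
  have htpos : 0 < t := abs_pos.mpr h0
  set r : ℝ := (L * t ^ (-σ)) ^ (1 / (N : ℝ)) with hr
  have hrpos : 0 < r := by positivity
  have hrN : r ^ N = L * t ^ (-σ) := by
    rw [hr, ← Real.rpow_natCast, ← Real.rpow_mul (by positivity)]
    rw [one_div_mul_cancel hNr.ne', Real.rpow_one]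
  set B : ℝ := A * (2 / t) ^ σ with hB
  have hBpos : 0 < B := by positivity
  have hvolr : r ^ N * ω = 2 * B := by
    rw [hrN, hL, hB, Real.div_rpow (by norm_num) htpos.le, Real.rpow_neg htpos.le]
    field_simp
  have hvol : volume (Metric.ball x r) = ENNReal.ofReal (2 * B) := by
    rw [Measure.addHaar_ball volume x hrpos.le, finrank_euclideanSpace_fin, hωe,
      ← ENNReal.ofReal_mul (by positivity), hvolr]
  set S : Set (Sp N) := {y | t / 2 ≤ |u y|} with hS
  have hSm : MeasurableSet S := measurableSet_le measurable_const hu.abs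
  have hSv : volume S ≤ ENNReal.ofReal B := by
    have hm : Measurable fun y => ENNReal.ofReal (|u y| ^ σ) := by fun_prop
    have h1 := meas_ge_le_lintegral_div (μ := (volume : Measure (Sp N))) hm.aemeasurable
      (ε := ENNReal.ofReal ((t / 2) ^ σ)) (by
        rw [Ne, ENNReal.ofReal_eq_zero, not_le]; positivity) ENNReal.ofReal_ne_top
    have h2 : S ⊆ {y | ENNReal.ofReal ((t / 2) ^ σ) ≤ ENNReal.ofReal (|u y| ^ σ)} := by
      intro y hy
      exact ENNReal.ofReal_le_ofReal (Real.rpow_le_rpow (by positivity) hy hσ.le)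
    refine (measure_mono h2).trans (h1.trans ?_)
    refine (ENNReal.div_le_div_right hI _).trans ?_
    rw [← ENNReal.ofReal_div_of_pos (by positivity)]
    apply ENNReal.ofReal_le_ofReal
    apply le_of_eq
    rw [hB, Real.div_rpow (by norm_num) htpos.le, Real.div_rpow htpos.le (by norm_num)]
    field_simp
  set T : Set (Sp N) := Metric.ball x r \ S with hT
  have hTm : MeasurableSet T := measurableSet_ball.diff hSm
  have hTv : ENNReal.ofReal B ≤ volume T := by
    refine le_trans ?_ (le_measure_diff (μ := volume) (s₁ := Metric.ball x r) (s₂ := S))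
    rw [hvol]
    refine le_trans ?_ (tsub_le_tsub_left hSv _)
    rw [← ENNReal.ofReal_sub _ hBpos.le]
    apply ENNReal.ofReal_le_ofReal; linarith
  have hG : ENNReal.ofReal (t ^ 2 / 4 * r ^ (-(N : ℝ) - 2 * s)) * ENNReal.ofReal B ≤
      ∫⁻ y, ENNReal.ofReal ((u x - u y) ^ 2 * ‖x - y‖ ^ (-(N : ℝ) - 2 * s)) := by
    calc _ ≤ ENNReal.ofReal (t ^ 2 / 4 * r ^ (-(N : ℝ) - 2 * s)) * volume T := by gcongr
      _ = ∫⁻ y in T, ENNReal.ofReal (t ^ 2 / 4 * r ^ (-(N : ℝ) - 2 * s)) := by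
        rw [setLIntegral_const]
      _ ≤ ∫⁻ y in T, ENNReal.ofReal ((u x - u y) ^ 2 * ‖x - y‖ ^ (-(N : ℝ) - 2 * s)) := by
        apply setLIntegral_mono' hTm
        intro y hy
        have hy1 : ‖x - y‖ < r := by
          have := hy.1
          rw [Metric.mem_ball, dist_comm, dist_eq_norm] at this
          exact this
        have hy2 : |u y| < t / 2 := by
          have := hy.2
          simpa [hS] using this
        have hxy : 0 < ‖x - y‖ := by
          rw [norm_pos_iff, sub_ne_zero]
          rintro rfl
          have : t < t / 2 := hy2
          linarith
        have hd : t / 2 ≤ |u x - u y| := by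
          have := abs_sub_abs_le_abs_sub (u x) (u y)
          linarith
        apply ENNReal.ofReal_le_ofReal
        apply mul_le_mul
        · rw [← sq_abs (u x - u y)]
          nlinarith
        · exact Real.rpow_le_rpow_of_nonpos hxy hy1.le (by linarith)
        · positivity
        · positivity
      _ ≤ _ := setLIntegral_le_lintegral _ _
  refine le_trans ?_ (mul_le_mul_right hG _)
  rw [← ENNReal.ofReal_mul (by positivity), ← ENNReal.ofReal_mul (by positivity)]
  apply ENNReal.ofReal_le_ofReal
  apply le_of_eq
  have e1 : r ^ (-(N : ℝ) - 2 * s) * B = ω / 2 * r ^ (-(2 * s)) := by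
    have : r ^ (-(N : ℝ) - 2 * s) = (r ^ N)⁻¹ * r ^ (-(2 * s)) := by
      rw [sub_eq_add_neg, Real.rpow_add hrpos, Real.rpow_neg hrpos.le, Real.rpow_natCast]
    rw [this]
    have hB' : B = r ^ N * ω / 2 := by linarith
    rw [hB']
    field_simp
  have e2 : r ^ (-(2 * s)) = (L ^ (2 * s / N))⁻¹ * t ^ (2 * s * σ / N) := by
    rw [hr, ← Real.rpow_mul (by positivity), Real.mul_rpow hLpos.le (by positivity),
      ← Real.rpow_mul htpos.le, ← Real.rpow_neg hLpos.le]
    congr 2 <;> field_simp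
  rw [Real.rpow_add htpos, Real.rpow_two]
  calc _ = 8 / ω * L ^ (2 * s / N) * (t ^ 2 / 4) * (ω / 2 * ((L ^ (2 * s / N))⁻¹ * t ^ (2 * s * σ / N))) := by
        have : L ^ (2 * s / N) ≠ 0 := by positivity
        field_simp
        norm_num
    _ = 8 / ω * L ^ (2 * s / N) * (t ^ 2 / 4) * (r ^ (-(N : ℝ) - 2 * s) * B) := by rw [e1, e2]
    _ = _ := by ring

/-- bounded sets in the fractional Sobolev space -/
def hlpGood (N : ℕ) (s M : ℝ) (u : Sp N → ℝ) : Prop :=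
  Measurable u ∧ ∫⁻ x, ENNReal.ofReal (u x ^ 2) ≤ ENNReal.ofReal M ∧
  ∫⁻ z : Sp N × Sp N, ENNReal.ofReal ((u z.1 - u z.2) ^ 2 * ‖z.1 - z.2‖ ^ (-(N : ℝ) - 2 * s)) ≤ 1

def hlpP (N : ℕ) (s M σ : ℝ) : Prop :=
  ∃ A : ℝ, 0 < A ∧ ∀ u, hlpGood N s M u → ∫⁻ x, ENNReal.ofReal (|u x| ^ σ) ≤ ENNReal.ofReal A

lemma hlp_step (N : ℕ) (hN : 0 < N) (s M σ : ℝ) (hs : 0 < s) (hσ : 0 < σ)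
    (h : hlpP N s M σ) : hlpP N s M (2 + 2 * s * σ / N) := by
  obtain ⟨A, hA, hAu⟩ := h
  obtain ⟨C, hC, hCu⟩ := hlp_ptwise N hN s σ A hs hσ hA
  refine ⟨C, hC, fun u hu => ?_⟩
  have hu' := hu
  obtain ⟨hm, -, hg⟩ := hu
  have hmeas : Measurable fun z : Sp N × Sp N =>
      ENNReal.ofReal ((u z.1 - u z.2) ^ 2 * ‖z.1 - z.2‖ ^ (-(N : ℝ) - 2 * s)) := by fun_prop
  calc _ ≤ ∫⁻ x, ENNReal.ofReal C * ∫⁻ y,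
        ENNReal.ofReal ((u x - u y) ^ 2 * ‖x - y‖ ^ (-(N : ℝ) - 2 * s)) :=
        lintegral_mono (hCu u hm (hAu u hu'))
    _ = ENNReal.ofReal C * ∫⁻ x, ∫⁻ y,
        ENNReal.ofReal ((u x - u y) ^ 2 * ‖x - y‖ ^ (-(N : ℝ) - 2 * s)) :=
        lintegral_const_mul' _ _ ENNReal.ofReal_ne_top
    _ ≤ ENNReal.ofReal C * 1 := by
        rw [Measure.volume_eq_prod, lintegral_prod _ hmeas.aemeasurable] at hg
        gcongr
    _ = _ := mul_one _

lemma hlp_two (N : ℕ) (s M : ℝ) (hM : 0 < M) : hlpP N s M 2 := by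
  refine ⟨M, hM, fun u hu => ?_⟩
  have := hu.2.1
  simpa using this

lemma hlp_mono (N : ℕ) (s M σ ρ : ℝ) (hM : 0 < M) (h2 : 2 ≤ ρ) (hρ : ρ ≤ σ)
    (h : hlpP N s M σ) : hlpP N s M ρ := by
  obtain ⟨A, hA, hAu⟩ := h
  refine ⟨M + A, by positivity, fun u hu => ?_⟩
  have hm := hu.1
  calc _ ≤ ∫⁻ x, (ENNReal.ofReal (u x ^ 2) + ENNReal.ofReal (|u x| ^ σ)) := by
        apply lintegral_mono
        intro x
        dsimp only
        rw [← ENNReal.ofReal_add (by positivity) (by positivity)]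
        apply ENNReal.ofReal_le_ofReal
        have h1 : u x ^ 2 = |u x| ^ (2 : ℝ) := by simp
        rw [h1]
        rcases le_total |u x| 1 with h | h
        · rcases eq_or_lt_of_le (abs_nonneg (u x)) with h0 | h0
          · rw [← h0, Real.zero_rpow (by linarith)]; positivity
          · have := Real.rpow_le_rpow_of_exponent_ge h0 h h2
            have : 0 ≤ |u x| ^ σ := by positivity
            linarith
        · have := Real.rpow_le_rpow_of_exponent_le h hρ
          have : 0 ≤ |u x| ^ (2 : ℝ) := by positivity
          linarith
    _ = (∫⁻ x, ENNReal.ofReal (u x ^ 2)) + ∫⁻ x, ENNReal.ofReal (|u x| ^ σ) :=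
        lintegral_add_left (by fun_prop) _
    _ ≤ ENNReal.ofReal M + ENNReal.ofReal A := add_le_add hu.2.1 (hAu u hu)
    _ = _ := (ENNReal.ofReal_add hM.le hA.le).symm

lemma hlp_sobolev (N : ℕ) (hN : 0 < N) (s M ρ : ℝ) (hs : 0 < s) (hM : 0 < M) (h2 : 2 ≤ ρ)
    (hρ : ρ * (N - 2 * s) < 2 * N) (hNs : 0 < N - 2 * s) : hlpP N s M ρ := by
  have hNr : (0 : ℝ) < N := by exact_mod_cast hN
  set δ : ℝ := 2 - ρ * (N - 2 * s) / N with hδ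
  have hδpos : 0 < δ := by
    rw [hδ, sub_pos, div_lt_iff₀ hNr]; exact hρ
  have key : ∀ n : ℕ, hlpP N s M (min (2 + n * δ) ρ) := by
    intro n
    induction n with
    | zero => simpa [h2] using hlp_two N s M hM
    | succ k ih =>
      set σ := min (2 + k * δ) ρ with hσ
      have hσ2 : 2 ≤ σ := le_min (by nlinarith [mul_nonneg (Nat.cast_nonneg (α := ℝ) k) hδpos.le]) h2
      have hσρ : σ ≤ ρ := min_le_right _ _
      have hst := hlp_step N hN s M σ hs (by linarith) ih
      refine hlp_mono N s M _ _ hM ?_ ?_ hst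
      · refine le_min ?_ h2
        have : (0 : ℝ) ≤ ((k + 1 : ℕ) : ℝ) * δ := by positivity
        linarith
      · have h1 : σ + δ ≤ 2 + 2 * s * σ / N := by
          rw [hδ]
          have : σ * (N - 2 * s) / N ≤ ρ * (N - 2 * s) / N := by gcongr
          have e : σ * (N - 2 * s) / N = σ - 2 * s * σ / N := by field_simp
          linarith
        refine le_trans ?_ h1
        rcases le_total (2 + k * δ) ρ with h | h
        · refine (min_le_left _ _).trans ?_
          rw [hσ, min_eq_left h]; push_cast; linarith
        · refine (min_le_right _ _).trans ?_
          rw [hσ, min_eq_right h]; linarith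
  obtain ⟨n, hn⟩ := exists_nat_gt (ρ / δ)
  rw [div_lt_iff₀ hδpos] at hn
  have := key n
  rwa [min_eq_right (by linarith)] at this

lemma hlp_young_pt (τ m a b k : ℝ) (hτ0 : 0 < τ) (hτ1 : τ < 1) (ha : 0 ≤ a) (hb : 0 ≤ b)
    (hk : 0 ≤ k) :
    a ^ m * b ^ m * k ≤ a ^ (2 * m / (2 - τ)) * b ^ (2 * m / (2 - τ))
      + a ^ (2 * m / (2 - τ)) * k ^ (1 / τ) + b ^ (2 * m / (2 - τ)) * k ^ (1 / τ) := by
  set ρ := 2 * m / (2 - τ) with hρ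
  have h2 : 2 - τ ≠ 0 := by linarith
  have hA : 0 ≤ a ^ ρ := by positivity
  have hB : 0 ≤ b ^ ρ := by positivity
  have hK : 0 ≤ k ^ (1 / τ) := by positivity
  have key := Real.geom_mean_le_arith_mean3_weighted (w₁ := 1 - τ) (w₂ := τ / 2) (w₃ := τ / 2)
    (p₁ := a ^ ρ * b ^ ρ) (p₂ := a ^ ρ * k ^ (1 / τ)) (p₃ := b ^ ρ * k ^ (1 / τ))
    (by linarith) (by linarith) (by linarith) (by positivity) (by positivity) (by positivity)
    (by ring)
  have haux : ∀ c : ℝ, 0 ≤ c → (c ^ ρ) ^ (1 - τ) * (c ^ ρ) ^ (τ / 2) = c ^ m := by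
    intro c hc
    rw [← Real.rpow_add_of_nonneg (by positivity) (by linarith) (by linarith), ← Real.rpow_mul hc]
    congr 1
    rw [hρ]; field_simp; ring
  have haux2 : (k ^ (1 / τ)) ^ (τ / 2) * (k ^ (1 / τ)) ^ (τ / 2) = k := by
    rw [← Real.rpow_add_of_nonneg (by positivity) (by linarith) (by linarith), ← Real.rpow_mul hk]
    rw [show 1 / τ * (τ / 2 + τ / 2) = 1 by field_simp; norm_num, Real.rpow_one]
  rw [Real.mul_rpow hA hB, Real.mul_rpow hA hK, Real.mul_rpow hB hK] at key
  calc a ^ m * b ^ m * k = ((a ^ ρ) ^ (1 - τ) * (a ^ ρ) ^ (τ / 2)) *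
        ((b ^ ρ) ^ (1 - τ) * (b ^ ρ) ^ (τ / 2)) *
        ((k ^ (1 / τ)) ^ (τ / 2) * (k ^ (1 / τ)) ^ (τ / 2)) := by
        rw [haux a ha, haux b hb, haux2]
    _ ≤ _ := by
        refine le_trans (le_of_eq (by ring)) (key.trans ?_)
        have h1 : 0 ≤ a ^ ρ * b ^ ρ := by positivity
        have h2 : 0 ≤ a ^ ρ * k ^ (1 / τ) := by positivity
        have h3 : 0 ≤ b ^ ρ * k ^ (1 / τ) := by positivity
        nlinarith

lemma hlp_young (N : ℕ) (τ m : ℝ) (hτ0 : 0 < τ) (hτ1 : τ < 1) (k : Sp N → ℝ) (hk : Measurable k)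
    (hk0 : ∀ z, 0 ≤ k z) (u : Sp N → ℝ) (hu : Measurable u) :
    ∫⁻ z : Sp N × Sp N, ENNReal.ofReal (|u z.1| ^ m * |u z.2| ^ m * k (z.1 - z.2)) ≤
      (∫⁻ x, ENNReal.ofReal (|u x| ^ (2 * m / (2 - τ)))) *
        (∫⁻ x, ENNReal.ofReal (|u x| ^ (2 * m / (2 - τ))))
      + (∫⁻ x, ENNReal.ofReal (|u x| ^ (2 * m / (2 - τ)))) * (∫⁻ x, ENNReal.ofReal (k x ^ (1 / τ)))
      + (∫⁻ x, ENNReal.ofReal (|u x| ^ (2 * m / (2 - τ)))) *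
        (∫⁻ x, ENNReal.ofReal (k x ^ (1 / τ))) := by
  set ρ := 2 * m / (2 - τ) with hρ
  set f : Sp N → ENNReal := fun x => ENNReal.ofReal (|u x| ^ ρ) with hf
  set g : Sp N → ENNReal := fun x => ENNReal.ofReal (k x ^ (1 / τ)) with hg
  have hfm : Measurable f := by fun_prop
  have hgm : Measurable g := by fun_prop
  calc _ ≤ ∫⁻ z : Sp N × Sp N, (f z.1 * f z.2 + f z.1 * g (z.1 - z.2) + f z.2 * g (z.1 - z.2)) := by
        apply lintegral_mono
        intro z
        have := hlp_young_pt τ m |u z.1| |u z.2| (k (z.1 - z.2)) hτ0 hτ1 (abs_nonneg _)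
          (abs_nonneg _) (hk0 _)
        refine (ENNReal.ofReal_le_ofReal this).trans (le_of_eq ?_)
        have hkk := Real.rpow_nonneg (hk0 (z.1 - z.2)) (1 / τ)
        rw [ENNReal.ofReal_add (by positivity) (by positivity),
          ENNReal.ofReal_add (by positivity) (by positivity),
          ENNReal.ofReal_mul (by positivity), ENNReal.ofReal_mul (by positivity),
          ENNReal.ofReal_mul (by positivity)]
    _ = (∫⁻ z : Sp N × Sp N, f z.1 * f z.2) + (∫⁻ z : Sp N × Sp N, f z.1 * g (z.1 - z.2))
        + ∫⁻ z : Sp N × Sp N, f z.2 * g (z.1 - z.2) := by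
        rw [lintegral_add_left (by fun_prop), lintegral_add_left (by fun_prop)]
    _ = _ := by
        congr 1
        · congr 1
          · rw [Measure.volume_eq_prod, lintegral_prod_mul hfm.aemeasurable hfm.aemeasurable]
          · rw [Measure.volume_eq_prod, lintegral_prod _ (by fun_prop)]
            simp only
            rw [← lintegral_mul_const _ hfm]
            congr 1; ext x
            rw [lintegral_const_mul _ (by fun_prop), lintegral_sub_left_eq_self g x]
        · rw [Measure.volume_eq_prod, lintegral_prod_symm _ (by fun_prop)]
          simp only
          rw [← lintegral_mul_const _ hfm]
          congr 1; ext x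
          rw [lintegral_const_mul _ (by fun_prop), lintegral_sub_right_eq_self g x]

lemma hlp_ker_in (N : ℕ) (hN : 0 < N) (c : ℝ) (hc : -(N : ℝ) < c) :
    IntegrableOn (fun x : Sp N => ‖x‖ ^ c) (Metric.ball 0 1) := by
  have : Nonempty (Fin N) := ⟨⟨0, hN⟩⟩
  have h := integrableOn_fun_norm_addHaar (μ := (volume : Measure (Sp N)))
    (f := fun t : ℝ => t ^ c) (r := 1)
  rw [h, finrank_euclideanSpace_fin]
  have h2 : IntegrableOn (fun y : ℝ => y ^ ((N : ℝ) - 1 + c)) (Set.Ioo 0 1) :=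
    (intervalIntegral.integrableOn_Ioo_rpow_iff one_pos).2 (by linarith)
  refine h2.congr_fun ?_ measurableSet_Ioo
  intro y hy
  simp only [smul_eq_mul]
  rw [Real.rpow_add hy.1, ← Real.rpow_natCast, Nat.cast_sub (by omega)]
  simp

lemma hlp_ker_out (N : ℕ) (c : ℝ) (hc : c < -(N : ℝ)) :
    ∫⁻ x : Sp N, ENNReal.ofReal (if ‖x‖ < 1 then 0 else ‖x‖ ^ c) < ⊤ := by
  have h := finite_integral_one_add_norm (E := Sp N) (μ := volume) (r := -c)
    (by rw [finrank_euclideanSpace_fin]; linarith)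
  have hc0 : c ≤ 0 := by
    have : (0 : ℝ) ≤ N := Nat.cast_nonneg _
    linarith
  refine lt_of_le_of_lt (b := ∫⁻ x : Sp N, ENNReal.ofReal (2 ^ (-c)) *
    ENNReal.ofReal ((1 + ‖x‖) ^ (-(-c)))) ?_ ?_
  · apply lintegral_mono
    intro x
    dsimp only
    rw [← ENNReal.ofReal_mul (by positivity)]
    apply ENNReal.ofReal_le_ofReal
    split_ifs with hx
    · positivity
    · rw [not_lt] at hx
      rw [neg_neg]
      have h1 : (2 * ‖x‖) ^ c ≤ (1 + ‖x‖) ^ c :=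
        Real.rpow_le_rpow_of_nonpos (by positivity) (by linarith) hc0
      rw [Real.mul_rpow (by norm_num) (by positivity)] at h1
      calc ‖x‖ ^ c = 2 ^ (-c) * (2 ^ c * ‖x‖ ^ c) := by
            rw [← mul_assoc, ← Real.rpow_add (by norm_num)]; simp
        _ ≤ _ := by gcongr
  · rw [lintegral_const_mul' _ _ ENNReal.ofReal_ne_top]
    exact ENNReal.mul_lt_top ENNReal.ofReal_lt_top h

lemma hlp_exists_tau (N s γ m : ℝ) (hN : 0 < N) (hNs : 0 < N - 2 * s) (hγ0 : 0 < γ) (hγ1 : γ < N)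
    (hml : (N + γ) / N < m) (hmu : m < (N + γ) / (N - 2 * s)) :
    ∃ τ₁ τ₂ : ℝ, (0 < τ₁ ∧ τ₁ < 1 ∧ 2 ≤ 2 * m / (2 - τ₁) ∧ 2 * m / (2 - τ₁) * (N - 2 * s) < 2 * N) ∧
      (0 < τ₂ ∧ τ₂ < 1 ∧ 2 ≤ 2 * m / (2 - τ₂) ∧ 2 * m / (2 - τ₂) * (N - 2 * s) < 2 * N) ∧
      -N < (γ - N) / τ₁ ∧ (γ - N) / τ₂ < -N := by
  set τ : ℝ := (N - γ) / N with hτ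
  have hτ0 : 0 < τ := div_pos (by linarith) hN
  have hτ1 : τ < 1 := by rw [hτ, div_lt_one hN]; linarith
  have e2 : 2 - τ = (N + γ) / N := by rw [hτ]; field_simp; ring
  have h2p : 0 < 2 - τ := by linarith
  have hcont : ContinuousAt (fun t : ℝ => 2 * m / (2 - t)) τ :=
    ContinuousAt.div (by fun_prop) (by fun_prop) h2p.ne'
  rw [div_lt_iff₀ hN] at hml
  rw [lt_div_iff₀ hNs] at hmu
  have c1 : 2 < 2 * m / (2 - τ) := by
    rw [lt_div_iff₀ h2p, e2, mul_div_assoc', div_lt_iff₀ hN]; linarith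
  have c2 : 2 * m / (2 - τ) < 2 * N / (N - 2 * s) := by
    rw [lt_div_iff₀ hNs, div_mul_eq_mul_div, div_lt_iff₀ h2p, e2]
    rw [show 2 * N * ((N + γ) / N) = 2 * (N + γ) by field_simp]
    linarith
  have hev : ∀ᶠ t in 𝓝 τ, (0 < t ∧ t < 1) ∧ (2 < 2 * m / (2 - t) ∧ 2 * m / (2 - t) < 2 * N / (N - 2 * s)) :=
    ((lt_mem_nhds hτ0).and (gt_mem_nhds hτ1)).and
      ((hcont.eventually (lt_mem_nhds c1)).and (hcont.eventually (gt_mem_nhds c2)))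
  obtain ⟨ε, hε, hb⟩ := Metric.eventually_nhds_iff.1 hev
  have b1 := @hb (τ + ε / 2) (by rw [Real.dist_eq]; rw [abs_lt]; constructor <;> linarith)
  have b2 := @hb (τ - ε / 2) (by rw [Real.dist_eq]; rw [abs_lt]; constructor <;> linarith)
  have hNγ : N - γ = τ * N := by rw [hτ]; field_simp
  refine ⟨τ + ε / 2, τ - ε / 2, ⟨b1.1.1, b1.1.2, b1.2.1.le, (lt_div_iff₀ hNs).1 b1.2.2⟩,
    ⟨b2.1.1, b2.1.2, b2.2.1.le, (lt_div_iff₀ hNs).1 b2.2.2⟩, ?_, ?_⟩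
  · rw [lt_div_iff₀ b1.1.1]; nlinarith
  · rw [div_lt_iff₀ b2.1.1]; nlinarith

lemma hlp_D (N : ℕ) (hN : 0 < N) (s M γ m : ℝ) (hs : 0 < s) (hM : 0 < M)
    (hNs : 0 < (N : ℝ) - 2 * s) (hγ0 : 0 < γ) (hγ1 : γ < N)
    (hml : ((N : ℝ) + γ) / N < m) (hmu : m < ((N : ℝ) + γ) / ((N : ℝ) - 2 * s)) :
    ∃ C : ℝ, 0 < C ∧ ∀ u, hlpGood N s M u → Dnl N γ m u ≤ C := by
  have hNr : (0 : ℝ) < N := by exact_mod_cast hN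
  obtain ⟨τ₁, τ₂, ⟨a1, a2, a3, a4⟩, ⟨b1, b2, b3, b4⟩, h1, h2⟩ :=
    hlp_exists_tau N s γ m hNr hNs hγ0 hγ1 hml hmu
  obtain ⟨A₁, hA₁, hu₁⟩ := hlp_sobolev N hN s M _ hs hM a3 a4 hNs
  obtain ⟨A₂, hA₂, hu₂⟩ := hlp_sobolev N hN s M _ hs hM b3 b4 hNs
  set k₁ : Sp N → ℝ := fun x => if ‖x‖ < 1 then ‖x‖ ^ (γ - N) else 0 with hk₁
  set k₂ : Sp N → ℝ := fun x => if ‖x‖ < 1 then 0 else ‖x‖ ^ (γ - N) with hk₂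
  have hset : MeasurableSet {x : Sp N | ‖x‖ < 1} := measurableSet_lt measurable_norm measurable_const
  have m₁ : Measurable k₁ := Measurable.ite hset (by fun_prop) measurable_const
  have m₂ : Measurable k₂ := Measurable.ite hset measurable_const (by fun_prop)
  have n₁ : ∀ z, 0 ≤ k₁ z := fun z => by simp only [hk₁]; split_ifs <;> positivity
  have n₂ : ∀ z, 0 ≤ k₂ z := fun z => by simp only [hk₂]; split_ifs <;> positivity
  set κ₁ := ∫⁻ x, ENNReal.ofReal (k₁ x ^ (1 / τ₁)) with hκ₁
  set κ₂ := ∫⁻ x, ENNReal.ofReal (k₂ x ^ (1 / τ₂)) with hκ₂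
  have f₁ : κ₁ < ⊤ := by
    have := hlp_ker_in N hN _ h1
    rw [← integrable_indicator_iff measurableSet_ball] at this
    refine lt_of_le_of_lt (le_of_eq ?_) this.lintegral_lt_top
    apply lintegral_congr
    intro x
    congr 1
    simp only [hk₁, Set.indicator, Metric.mem_ball, dist_zero_right]
    split_ifs with hx
    · rw [← Real.rpow_mul (norm_nonneg _)]; congr 1; ring
    · rw [Real.zero_rpow]; positivity
  have f₂ : κ₂ < ⊤ := by
    refine lt_of_le_of_lt (le_of_eq ?_) (hlp_ker_out N _ h2)
    apply lintegral_congr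
    intro x
    congr 1
    simp only [hk₂]
    split_ifs with hx
    · rw [Real.zero_rpow]; positivity
    · rw [← Real.rpow_mul (norm_nonneg _)]; congr 1; ring
  set E : ENNReal := (ENNReal.ofReal A₁ * ENNReal.ofReal A₁ + ENNReal.ofReal A₁ * κ₁ +
    ENNReal.ofReal A₁ * κ₁) + (ENNReal.ofReal A₂ * ENNReal.ofReal A₂ + ENNReal.ofReal A₂ * κ₂ +
    ENNReal.ofReal A₂ * κ₂) with hE
  have hEt : E ≠ ⊤ := by
    have := f₁.ne
    have := f₂.ne
    simp only [hE]
    finiteness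
  refine ⟨E.toReal + 1, by positivity, fun u hu => ?_⟩
  have hm := hu.1
  have hle : ∫⁻ z : Sp N × Sp N, ENNReal.ofReal (|u z.1| ^ m * |u z.2| ^ m * ‖z.1 - z.2‖ ^ (γ - (N : ℝ))) ≤ E := by
    calc _ = ∫⁻ z : Sp N × Sp N, (ENNReal.ofReal (|u z.1| ^ m * |u z.2| ^ m * k₁ (z.1 - z.2)) +
          ENNReal.ofReal (|u z.1| ^ m * |u z.2| ^ m * k₂ (z.1 - z.2))) := by
          apply lintegral_congr
          intro z
          simp only [hk₁, hk₂]
          split_ifs <;> simp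
      _ = (∫⁻ z : Sp N × Sp N, ENNReal.ofReal (|u z.1| ^ m * |u z.2| ^ m * k₁ (z.1 - z.2))) +
          ∫⁻ z : Sp N × Sp N, ENNReal.ofReal (|u z.1| ^ m * |u z.2| ^ m * k₂ (z.1 - z.2)) :=
          lintegral_add_left (by fun_prop) _
      _ ≤ E := by
          have i1 := hu₁ u hu
          have i2 := hu₂ u hu
          refine add_le_add ((hlp_young N τ₁ m a1 a2 k₁ m₁ n₁ u hm).trans ?_)
            ((hlp_young N τ₂ m b1 b2 k₂ m₂ n₂ u hm).trans ?_)
          · gcongr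
          · gcongr
  rw [Dnl, integral_eq_lintegral_of_nonneg_ae (Eventually.of_forall fun z => by positivity)
    (Measurable.aestronglyMeasurable (by fun_prop))]
  have := ENNReal.toReal_mono hEt hle
  linarith

lemma hlp_scale_D (N : ℕ) (γ m c : ℝ) (hc : 0 < c) (u : Sp N → ℝ) :
    Dnl N γ m (fun x => c * u x) = (c ^ 2) ^ m * Dnl N γ m u := by
  rw [Dnl, Dnl, ← integral_const_mul]
  congr 1; ext z
  rw [abs_mul, abs_mul, abs_of_pos hc, Real.mul_rpow hc.le (abs_nonneg _),
    Real.mul_rpow hc.le (abs_nonneg _), sq, Real.mul_rpow hc.le hc.le]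
  ring

lemma hlp_Dnonneg (N : ℕ) (γ m : ℝ) (u : Sp N → ℝ) : 0 ≤ Dnl N γ m u :=
  integral_nonneg fun z => by positivity

lemma hlp_gag_nonneg (N : ℕ) (s : ℝ) (u : Sp N → ℝ) : 0 ≤ gagSq N s u :=
  integral_nonneg fun z => by positivity

lemma hlp_normSq_pos (N : ℕ) (s V₀ : ℝ) (V : Sp N → ℝ) (hV₀ : 0 < V₀) (hV : ∀ x, V₀ ≤ V x)
    (u : Sp N → ℝ) (hu : memX N s V u) (hnz : nonzero N u) : 0 < normSq N s V u := by
  have hVp : ∀ x, 0 < V x := fun x => hV₀.trans_le (hV x)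
  have hnn : ∀ x, 0 ≤ V x * u x ^ 2 := fun x => mul_nonneg (hVp x).le (sq_nonneg _)
  refine add_pos_of_nonneg_of_pos (hlp_gag_nonneg N s u) ?_
  refine lt_of_le_of_ne (integral_nonneg hnn) fun h => hnz ?_
  have := (integral_eq_zero_iff_of_nonneg hnn hu.2.2).1 h.symm
  filter_upwards [this] with x hx
  have hx' : V x * u x ^ 2 = 0 := hx
  simpa [(hVp x).ne'] using hx'

lemma hlp_good (N : ℕ) (s V₀ : ℝ) (V : Sp N → ℝ) (hV₀ : 0 < V₀) (hV : ∀ x, V₀ ≤ V x)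
    (u : Sp N → ℝ) (hu : memX N s V u) (c : ℝ) (hc : c ^ 2 * normSq N s V u = 1) :
    hlpGood N s (1 / V₀) (fun x => c * u x) := by
  have hVp : ∀ x, 0 < V x := fun x => hV₀.trans_le (hV x)
  have hnn : ∀ x, 0 ≤ V x * u x ^ 2 := fun x => mul_nonneg (hVp x).le (sq_nonneg _)
  obtain ⟨hm, hg, hv⟩ := hu
  have hg0 := hlp_gag_nonneg N s u
  have hv0 : 0 ≤ ∫ x, V x * u x ^ 2 := integral_nonneg hnn
  rw [normSq] at hc
  refine ⟨by fun_prop, ?_, ?_⟩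
  · calc _ ≤ ∫⁻ x, ENNReal.ofReal (c ^ 2 / V₀ * (V x * u x ^ 2)) := by
          apply lintegral_mono
          intro x
          apply ENNReal.ofReal_le_ofReal
          have h1 : 1 ≤ V x / V₀ := by rw [one_le_div hV₀]; exact hV x
          calc (c * u x) ^ 2 = 1 * (c * u x) ^ 2 := by ring
            _ ≤ V x / V₀ * (c * u x) ^ 2 := by gcongr
            _ = _ := by ring
      _ = ENNReal.ofReal (∫ x, c ^ 2 / V₀ * (V x * u x ^ 2)) :=
          (ofReal_integral_eq_lintegral_ofReal (hv.const_mul _)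
            (Eventually.of_forall fun x => mul_nonneg (by positivity) (hnn x))).symm
      _ ≤ _ := by
          apply ENNReal.ofReal_le_ofReal
          rw [integral_const_mul, div_mul_eq_mul_div]
          gcongr
          nlinarith [mul_nonneg (sq_nonneg c) hg0]
  · calc _ = ∫⁻ z : Sp N × Sp N, ENNReal.ofReal (c ^ 2 * ((u z.1 - u z.2) ^ 2 * ‖z.1 - z.2‖ ^ (-(N : ℝ) - 2 * s))) := by
          apply lintegral_congr
          intro z
          congr 1
          ring
      _ = ENNReal.ofReal (c ^ 2 * gagSq N s u) := by
          rw [gagSq, ← integral_const_mul]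
          exact (ofReal_integral_eq_lintegral_ofReal (hg.const_mul _)
            (Eventually.of_forall fun x => by positivity)).symm
      _ ≤ 1 := by
          rw [ENNReal.ofReal_le_one]
          nlinarith [mul_nonneg (sq_nonneg c) hv0]

lemma hlp_Dbound (N : ℕ) (s V₀ γ m C : ℝ) (V : Sp N → ℝ) (hV₀ : 0 < V₀) (hV : ∀ x, V₀ ≤ V x)
    (hC : ∀ u, hlpGood N s (1 / V₀) u → Dnl N γ m u ≤ C)
    (u : Sp N → ℝ) (hu : memX N s V u) (hn : 0 < normSq N s V u) :
    Dnl N γ m u ≤ C * normSq N s V u ^ m := by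
  set n := normSq N s V u with hnd
  set c := (√n)⁻¹ with hc
  have hcp : 0 < c := by positivity
  have hc2 : c ^ 2 = n⁻¹ := by rw [hc, inv_pow, Real.sq_sqrt hn.le]
  have := hC _ (hlp_good N s V₀ V hV₀ hV u hu c (by rw [hc2, ← hnd]; field_simp))
  rw [hlp_scale_D N γ m c hcp u, hc2, Real.inv_rpow hn.le] at this
  rwa [inv_mul_le_iff₀ (by positivity), mul_comm] at this

/-- `E_λ` restricted to the Nehari manifold is bounded below by a positive constant,
and in fact `E_λ(u) ≥ (1/2 - 1/(2q)) ‖u‖²` on `N_λ`. -/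
theorem energy_bounded_below_on_nehari
    (N : ℕ) (s α β p q lam : ℝ) (V : Sp N → ℝ)
    (hN : 3 ≤ N) (hs : s ∈ Set.Ioo (0 : ℝ) 1)
    (hα : α ∈ Set.Ioo (0 : ℝ) (N : ℝ)) (hβ : β ∈ Set.Ioo (0 : ℝ) (N : ℝ))
    (hV : Continuous V) (hV1 : ∃ V₀ > 0, ∀ x, V₀ ≤ V x)
    (hq1 : 1 < q) (hpq : q < p) (hlam : 0 < lam)
    (hpl : ((N : ℝ) + α) / N < p) (hpu : p < ((N : ℝ) + α) / ((N : ℝ) - 2 * s))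
    (hql : ((N : ℝ) + β) / N < q) (hqu : q < ((N : ℝ) + β) / ((N : ℝ) - 2 * s)) :
    (∃ c > (0 : ℝ), ∀ u ∈ NehariD N s α β p q lam V, c ≤ energy N s α β p q lam V u) ∧
    (∀ u ∈ NehariD N s α β p q lam V,
      (1 / 2 - 1 / (2 * q)) * normSq N s V u ≤ energy N s α β p q lam V u) := by
  obtain ⟨V₀, hV₀, hVx⟩ := hV1
  have hN0 : 0 < N := by omega
  have hN3 : (3 : ℝ) ≤ N := by exact_mod_cast hN
  have hNs : 0 < (N : ℝ) - 2 * s := by have := hs.2; linarith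
  have hq0 : 0 < q := by linarith
  have hp0 : 0 < p := by linarith
  have hpos : 0 < 1 / 2 - 1 / (2 * q) := by
    rw [sub_pos]
    exact one_div_lt_one_div_of_lt (by norm_num) (by linarith)
  have second : ∀ u ∈ NehariD N s α β p q lam V,
      (1 / 2 - 1 / (2 * q)) * normSq N s V u ≤ energy N s α β p q lam V u := by
    rintro u ⟨-, -, hE⟩
    have hD := hlp_Dnonneg N α p u
    have h1 : Dnl N α p u / (2 * p) ≤ Dnl N α p u / (2 * q) := by gcongr
    have h2 : (1 / 2 - 1 / (2 * q)) * normSq N s V u = normSq N s V u / 2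
        - Dnl N α p u / (2 * q) - lam * Dnl N β q u / (2 * q) := by
      rw [sub_mul, hE]; ring
    rw [h2, energy]
    linarith
  refine ⟨?_, second⟩
  obtain ⟨C₁, hC₁, hD₁⟩ := hlp_D N hN0 s (1 / V₀) α p hs.1 (by positivity) hNs hα.1 hα.2 hpl hpu
  obtain ⟨C₂, hC₂, hD₂⟩ := hlp_D N hN0 s (1 / V₀) β q hs.1 (by positivity) hNs hβ.1 hβ.2 hql hqu
  set K : ℝ := C₁ + lam * C₂ with hK
  have hKp : 0 < K := by positivity
  set c₀ : ℝ := min 1 (K⁻¹ ^ (1 / (q - 1))) with hc₀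
  have hc₀p : 0 < c₀ := lt_min one_pos (by positivity)
  refine ⟨(1 / 2 - 1 / (2 * q)) * c₀, by positivity, fun u hu => le_trans ?_ (second u hu)⟩
  refine mul_le_mul_of_nonneg_left ?_ hpos.le
  obtain ⟨hX, hnz, hE⟩ := hu
  have hn := hlp_normSq_pos N s V₀ V hV₀ hVx u hX hnz
  have d1 := hlp_Dbound N s V₀ α p C₁ V hV₀ hVx hD₁ u hX hn
  have d2 := hlp_Dbound N s V₀ β q C₂ V hV₀ hVx hD₂ u hX hn
  set n := normSq N s V u with hnd
  rcases le_total 1 n with h | h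
  · exact (min_le_left _ _).trans h
  refine (min_le_right _ _).trans ?_
  have hpq' : n ^ p ≤ n ^ q := Real.rpow_le_rpow_of_exponent_ge hn h hpq.le
  have hnK : n ≤ K * n ^ q := by
    have i1 : C₁ * n ^ p ≤ C₁ * n ^ q := by gcongr
    have i2 : lam * Dnl N β q u ≤ lam * (C₂ * n ^ q) := by gcongr
    rw [hK]; nlinarith
  have hq' : n ^ q = n * n ^ (q - 1) := by
    rw [← Real.rpow_one_add' hn.le (by linarith)]; congr 1; ring
  have hfin : K⁻¹ ≤ n ^ (q - 1) := by
    rw [hq'] at hnK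
    rw [inv_le_iff_one_le_mul₀ hKp]
    have : n * 1 ≤ n * (n ^ (q - 1) * K) := by linarith
    exact le_of_mul_le_mul_left this hn
  calc K⁻¹ ^ (1 / (q - 1)) ≤ (n ^ (q - 1)) ^ (1 / (q - 1)) :=
        Real.rpow_le_rpow (by positivity) hfin (by
          have : 0 < q - 1 := by linarith
          positivity)
    _ = n := by
        rw [← Real.rpow_mul hn.le, mul_one_div_cancel (by linarith), Real.rpow_one]
end
end
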